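/- arXiv:1403.4424 — 3 statements merged into one kernel-verified Lean document; each statement's English description precedes it below -/
import Mathlib

section
/- Suppose b(x,0) = 0 for all x ∈ ℝ^N. Then for every g ∈ L¹(ℝ^{N+1}) and every s ∈ ℝ, ∫_{ℝ^N × ℝ} g(Φ_s(y,η)) sgn(η) dy dη = ∫_{ℝ^N × ℝ} g(y,η) sgn(η) dy dη. -/
open MeasureTheory
open Filter Topology

section gen
set_option linter.unusedSectionVars false
variable {E : Type*} [NormedAddCommGroup E] [NormedSpace ℝ E] [FiniteDimensional ℝ E]

lemma aux_det_diff : Differentiable ℝ (fun M : E →L[ℝ] E => (1 + M).det) := by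
  classical
  let b := Module.finBasis ℝ E
  have h : (fun M : E →L[ℝ] E => (1 + M).det) = fun M : E →L[ℝ] E =>
      ∑ σ : Equiv.Perm (Fin (Module.finrank ℝ E)), ((Equiv.Perm.sign σ : ℤ) : ℝ) *
        ∏ i, (b.coord (σ i)).toContinuousLinearMap ((1 + M) (b i)) := by
    funext M
    have : (1 + M).det = LinearMap.det ((1 + M : E →L[ℝ] E) : E →ₗ[ℝ] E) := rfl
    rw [this, ← LinearMap.det_toMatrix b, Matrix.det_apply']
    simp [LinearMap.toMatrix_apply]
  rw [h]
  fun_prop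

lemma aux_det_deriv (M : E →L[ℝ] E) :
    HasDerivAt (fun r : ℝ => (1 + r • M).det) (LinearMap.trace ℝ E (M : E →ₗ[ℝ] E)) 0 := by
  classical
  let b := Module.finBasis ℝ E
  have h : (fun r : ℝ => (1 + r • M).det) = fun r : ℝ =>
      Matrix.det (1 + r • LinearMap.toMatrix b b (M : E →ₗ[ℝ] E)) := by
    funext r
    have : (1 + r • M).det = LinearMap.det ((1 + r • M : E →L[ℝ] E) : E →ₗ[ℝ] E) := rfl
    rw [this, ← LinearMap.det_toMatrix b]
    congr 1
    ext i j
    simp [LinearMap.toMatrix_apply, Matrix.one_apply, Finsupp.single_apply, eq_comm]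
  rw [h, LinearMap.trace_eq_matrix_trace ℝ b]
  rw [funext (fun r => Matrix.det_one_add_smul r (LinearMap.toMatrix b b (M : E →ₗ[ℝ] E)))]
  set P := (Matrix.det (1 + (Polynomial.X : Polynomial ℝ) • (LinearMap.toMatrix b b (M : E →ₗ[ℝ] E)).map Polynomial.C)).divX.divX
  set t := (LinearMap.toMatrix b b (M : E →ₗ[ℝ] E)).trace
  have h1 := ((hasDerivAt_id (0:ℝ)).const_mul t).const_add 1
  have h2 := (P.hasDerivAt 0).mul ((hasDerivAt_id (0:ℝ)).pow 2)
  exact (h1.add h2).congr_deriv (by simp)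

lemma aux_det_bound (ε : ℝ) (hε : 0 < ε) : ∃ δ > 0, ∀ M : E →L[ℝ] E, ‖M‖ ≤ δ →
    LinearMap.trace ℝ E (M : E →ₗ[ℝ] E) = 0 → 1 - ε * ‖M‖ ≤ |(1 + M).det| := by
  have hd := (aux_det_diff (E := E) 0).hasFDerivAt
  have hb := hd.isLittleO.bound hε
  rw [Metric.eventually_nhds_iff] at hb
  obtain ⟨δ, hδ, hb⟩ := hb
  refine ⟨δ / 2, by positivity, fun M hM ht => ?_⟩
  have h1 := hb (y := M) (by rw [dist_zero_right]; linarith)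
  have h2 : (fderiv ℝ (fun M : E →L[ℝ] E => (1 + M).det) 0) M = 0 := by
    have h3 : HasDerivAt (fun r : ℝ => r • M) M 0 := by
      simpa using (hasDerivAt_id (0:ℝ)).smul_const M
    have hd' : HasFDerivAt (fun M : E →L[ℝ] E => (1 + M).det)
      (fderiv ℝ (fun M : E →L[ℝ] E => (1 + M).det) 0) ((0:ℝ) • M) := by simpa using hd
    have h4 := hd'.comp_hasDerivAt (0:ℝ) h3
    have h5 := aux_det_deriv M
    rw [ht] at h5
    exact h4.unique h5
  have h6 : (1 : E →L[ℝ] E).det = 1 := by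
    simp [ContinuousLinearMap.det]
  simp only [sub_zero, h2, add_zero, h6, Real.norm_eq_abs] at h1
  have h7 := neg_abs_le ((1 + M).det - 1)
  have h8 := le_abs_self ((1 + M).det)
  linarith

lemma aux_euler {V : E → E} {K : NNReal} (hV : LipschitzWith K V) {u : ℝ → E}
    (hu : ∀ t, HasDerivAt u (V (u t)) t) :
    Tendsto (fun n : ℕ => ((fun x => x + (1 / (n:ℝ)) • V x)^[n]) (u 0)) atTop (𝓝 (u 1)) := by
  have hc : Continuous u := continuous_iff_continuousAt.2 fun t => (hu t).continuousAt
  obtain ⟨B, hB⟩ := (isCompact_Icc (a := (0:ℝ)) (b := 1)).exists_bound_of_continuousOn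
    (hV.continuous.comp hc).continuousOn
  have hB0 : 0 ≤ B := (norm_nonneg _).trans (hB 0 (by simp))
  have hLip : ∀ x ∈ Set.Icc (0:ℝ) 1, ∀ y ∈ Set.Icc (0:ℝ) 1, ‖u y - u x‖ ≤ B * ‖y - x‖ := by
    intro x hx y hy
    exact (convex_Icc (0:ℝ) 1).norm_image_sub_le_of_norm_hasDerivWithin_le
      (fun t _ => (hu t).hasDerivWithinAt) hB hx hy
  have hloc : ∀ t h : ℝ, 0 ≤ t → 0 ≤ h → t + h ≤ 1 →
      ‖u (t + h) - (u t + h • V (u t))‖ ≤ K * B * h ^ 2 := by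
    intro t h ht hh hth
    have := (convex_Icc t (t+h)).norm_image_sub_le_of_norm_hasDerivWithin_le
      (f := fun τ => u τ - τ • V (u t)) (f' := fun τ => V (u τ) - (1:ℝ) • V (u t)) (C := K * B * h)
      (x := t) (y := t + h)
      (fun τ _ => ((hu τ).sub ((hasDerivAt_id τ).smul_const (V (u t)))).hasDerivWithinAt)
      (fun τ hτ => by
        rw [one_smul]
        have h1 := hV.norm_sub_le (u τ) (u t)
        have h2 := hLip t ⟨ht, by linarith⟩ τ ⟨by linarith [hτ.1], by linarith [hτ.2]⟩
        have h3 : ‖τ - t‖ ≤ h := by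
          rw [Real.norm_eq_abs, abs_of_nonneg (by linarith [hτ.1])]; linarith [hτ.2]
        calc _ ≤ _ := h1
          _ ≤ K * (B * h) := by gcongr; exact h2.trans (by gcongr)
          _ = _ := by ring)
      ⟨le_refl _, by linarith⟩ ⟨by linarith, le_refl _⟩
    simp only [add_sub_cancel_left, Real.norm_eq_abs, abs_of_nonneg hh] at this
    calc _ = ‖u (t + h) - (t + h) • V (u t) - (u t - t • V (u t))‖ := by
            congr 1; rw [add_smul]; abel
      _ ≤ _ := this
      _ = _ := by ring
  have key : ∀ n : ℕ, 0 < n → ∀ k : ℕ, k ≤ n →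
      ‖u (k * (1 / (n:ℝ))) - ((fun x => x + (1 / (n:ℝ)) • V x)^[k]) (u 0)‖ ≤
        k * (K * B * (1 / (n:ℝ)) ^ 2) * (1 + K * (1 / (n:ℝ))) ^ k := by
    intro n hn k
    induction k with
    | zero => simp
    | succ k ih =>
      intro hk
      have ih := ih (by omega)
      rw [Function.iterate_succ_apply']
      have hn' : (0:ℝ) < n := by exact_mod_cast hn
      have hh : (k + 1 : ℝ) * (1 / (n:ℝ)) ≤ 1 := by
        rw [mul_one_div, div_le_one hn']; exact_mod_cast hk
      set h : ℝ := 1 / (n:ℝ) with hdef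
      have h0 : 0 ≤ h := by positivity
      set x := ((fun x => x + h • V x)^[k]) (u 0)
      have h1 := hloc (k * h) h (by positivity) h0 (by linarith)
      have h2 := hV.norm_sub_le (u (k * h)) x
      set y := u (k * h)
      have e : ((k + 1 : ℕ) : ℝ) * h = k * h + h := by push_cast; ring
      rw [e]
      have hp : (1:ℝ) ≤ (1 + K * h) ^ (k+1) := one_le_pow₀ (by
        have : 0 ≤ (K:ℝ) * h := by positivity
        linarith)
      calc ‖u (k * h + h) - (x + h • V x)‖
          = ‖(u (k * h + h) - (y + h • V y)) + ((y - x) + h • (V y - V x))‖ := by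
            congr 1; rw [smul_sub]; abel
        _ ≤ ‖u (k * h + h) - (y + h • V y)‖ + (‖y - x‖ + h * ‖V y - V x‖) := by
            refine (norm_add_le _ _).trans (add_le_add_right ((norm_add_le _ _).trans ?_) _)
            rw [norm_smul, Real.norm_eq_abs, abs_of_nonneg h0]
        _ ≤ K * B * h ^ 2 + (‖y - x‖ + h * (K * ‖y - x‖)) := by gcongr
        _ = K * B * h ^ 2 * 1 + (1 + K * h) * ‖y - x‖ := by ring
        _ ≤ K * B * h ^ 2 * (1 + K * h) ^ (k+1) +
            (1 + K * h) * (k * (K * B * h ^ 2) * (1 + K * h) ^ k) := by gcongr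
        _ = _ := by push_cast; ring
  rw [tendsto_iff_norm_sub_tendsto_zero]
  have hlim : Tendsto (fun n : ℕ => (K * B * Real.exp K) * (1 / (n:ℝ))) atTop (𝓝 0) := by
    simpa using tendsto_one_div_atTop_nhds_zero_nat.const_mul (K * B * Real.exp K)
  refine squeeze_zero' (Eventually.of_forall fun _ => norm_nonneg _) ?_ hlim
  filter_upwards [eventually_gt_atTop 0] with n hn
  have hn' : (0:ℝ) < n := by exact_mod_cast hn
  have := key n hn n le_rfl
  rw [mul_one_div_cancel hn'.ne'] at this
  rw [norm_sub_rev]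
  refine this.trans ?_
  have h1 : (1 + K * (1 / (n:ℝ))) ^ n ≤ Real.exp K := by
    have := Real.add_one_le_exp (K * (1 / (n:ℝ)))
    calc _ ≤ (Real.exp (K * (1 / (n:ℝ)))) ^ n := by gcongr; linarith
      _ = _ := by rw [← Real.exp_nat_mul]; congr 1; field_simp
  calc _ ≤ n * (K * B * (1 / (n:ℝ)) ^ 2) * Real.exp K := by gcongr
    _ = _ := by field_simp

variable [MeasurableSpace E] [BorelSpace E] (μ : Measure E) [μ.IsAddHaarMeasure]

/-- one Euler step -/
lemma aux_step {W : E → E} {W' : E → E →L[ℝ] E} (hW : ∀ x, HasFDerivAt W (W' x) x)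
    {k : NNReal} (hk : k < 1) (hL : LipschitzWith k W) (c : ENNReal)
    (hdet : ∀ x, c ≤ ENNReal.ofReal |(1 + W' x).det|) {S : Set E} (hS : MeasurableSet S) :
    c * μ ((fun x => x + W x) ⁻¹' S) ≤ μ S := by
  have hcont : Continuous (fun x => x + W x) := continuous_id.add hL.continuous
  have hT : MeasurableSet ((fun x => x + W x) ⁻¹' S) := hcont.measurable hS
  have hinj : Function.Injective (fun x => x + W x) := by
    intro x y hxy
    have h1 := hL.norm_sub_le x y
    have h2 : x - y = -(W x - W y) := by
      have : x + W x = y + W y := hxy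
      rw [neg_sub, sub_eq_sub_iff_add_eq_add, this]; abel
    rw [← norm_neg (W x - W y), ← h2] at h1
    have h3 : (k:ℝ) < 1 := by exact_mod_cast hk
    have h4 : ‖x - y‖ = 0 := by nlinarith [norm_nonneg (x - y)]
    exact sub_eq_zero.1 (norm_eq_zero.1 h4)
  have := lintegral_abs_det_fderiv_eq_addHaar_image μ hT (f := fun x => x + W x)
    (f' := fun x => 1 + W' x) (fun x _ => ((hasFDerivAt_id x).add (hW x)).hasFDerivWithinAt)
    hinj.injOn
  calc _ = ∫⁻ x in ((fun x => x + W x) ⁻¹' S), c ∂μ := by simp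
    _ ≤ _ := lintegral_mono hdet
    _ = _ := this
    _ ≤ _ := measure_mono (Set.image_preimage_subset _ _)

lemma aux_iter {f : E → E} (hf : Measurable f) (c : ENNReal)
    (h : ∀ S, MeasurableSet S → c * μ (f ⁻¹' S) ≤ μ S) (n : ℕ) :
    ∀ S, MeasurableSet S → c ^ n * μ (f^[n] ⁻¹' S) ≤ μ S := by
  induction n with
  | zero => simp
  | succ n ih =>
    intro S hS
    rw [Function.iterate_succ', Set.preimage_comp, pow_succ, mul_assoc] 
    have h1 := h (f^[n] ⁻¹' S) ((hf.iterate n) hS)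
    have h2 : f^[n] ⁻¹' (f ⁻¹' S) = f ⁻¹' (f^[n] ⁻¹' S) := by
      rw [← Set.preimage_comp, ← Set.preimage_comp, ← Function.iterate_succ, Function.iterate_succ']
    rw [h2]
    exact (mul_le_mul_right h1 _).trans (ih S hS)

lemma aux_open {V : E → E} {V' : E → E →L[ℝ] E} (hV' : ∀ x, HasFDerivAt V (V' x) x)
    (htr : ∀ x, LinearMap.trace ℝ E (V' x : E →ₗ[ℝ] E) = 0)
    {K : NNReal} (hV : LipschitzWith K V) {φ : E → E}
    (hφ : ∀ x, Tendsto (fun n : ℕ => ((fun x => x + (1 / (n:ℝ)) • V x)^[n]) x) atTop (𝓝 (φ x)))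
    {U : Set E} (hU : IsOpen U) : μ (φ ⁻¹' U) ≤ μ U := by
  -- for every ε in (0,1), eventually (1-ε) μ(Eₙ⁻¹ U) ≤ μ U
  have hK0 : (0:ℝ) ≤ K := K.2
  have hVb : ∀ x, ‖V' x‖ ≤ K := fun x => (hV' x).le_of_lipschitz hV
  have hcont : ∀ n : ℕ, Continuous (fun x => x + (1 / (n:ℝ)) • V x) := fun n =>
    continuous_id.add (hV.continuous.const_smul _)
  have key : ∀ ε : ℝ, 0 < ε → ε < 1 → ∀ᶠ n : ℕ in atTop,
      ENNReal.ofReal (1 - ε) * μ ((fun x => x + (1 / (n:ℝ)) • V x)^[n] ⁻¹' U) ≤ μ U := by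
    intro ε hε hε1
    obtain ⟨δ, hδ, hdet⟩ := aux_det_bound (E := E) (ε / (K + 1)) (by positivity)
    have t1 : Tendsto (fun n : ℕ => (1 / (n:ℝ)) * K) atTop (𝓝 0) := by
      simpa using tendsto_one_div_atTop_nhds_zero_nat.mul_const (K:ℝ)
    filter_upwards [eventually_gt_atTop 0, t1.eventually_lt_const hδ,
      t1.eventually_lt_const one_pos] with n hn h1 h2
    have hn' : (0:ℝ) < n := by exact_mod_cast hn
    have hn1 : (1:ℝ) ≤ n := by exact_mod_cast hn
    have hstep : ∀ S, MeasurableSet S → ENNReal.ofReal (1 - ε * (1 / n)) *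
        μ ((fun x => x + (1 / (n:ℝ)) • V x) ⁻¹' S) ≤ μ S := by
      intro S hS
      refine aux_step μ (W := fun x => (1 / (n:ℝ)) • V x) (W' := fun x => (1 / (n:ℝ)) • V' x)
        (fun x => (hV' x).const_smul _) (k := ⟨(1 / (n:ℝ)) * K, by positivity⟩) h2
        (LipschitzWith.of_dist_le_mul fun x y => ?_) _ (fun x => ?_) hS
      · rw [dist_smul₀, Real.norm_eq_abs, abs_of_nonneg (by positivity)]
        have := hV.dist_le_mul x y
        calc _ ≤ (1 / (n:ℝ)) * (K * dist x y) := by gcongr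
          _ = _ := by rw [← mul_assoc]; rfl
      · refine ENNReal.ofReal_le_ofReal ?_
        have h3 : ‖(1 / (n:ℝ)) • V' x‖ ≤ (1 / (n:ℝ)) * K := by
          rw [norm_smul, Real.norm_eq_abs, abs_of_nonneg (by positivity)]
          gcongr; exact hVb x
        refine le_trans ?_ (hdet _ (h3.trans h1.le) (by
          rw [ContinuousLinearMap.toLinearMap_smul, map_smul, htr, smul_zero]))
        have : ε / (K + 1) * ‖(1 / (n:ℝ)) • V' x‖ ≤ ε * (1 / n) := by
          calc _ ≤ ε / (K + 1) * ((1 / (n:ℝ)) * K) := by gcongr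
            _ = ε * (1 / n) * (K / (K + 1)) := by ring
            _ ≤ ε * (1 / n) * 1 := by
              gcongr; rw [div_le_one (by positivity)]; linarith
            _ = _ := by ring
        linarith
    refine le_trans ?_ (aux_iter μ (hcont n).measurable _ hstep n U hU.measurableSet)
    gcongr
    have hle : ε * (1 / (n:ℝ)) ≤ 1 := by
      rw [mul_one_div, div_le_one hn']; linarith
    rw [← ENNReal.ofReal_pow (by linarith)]
    refine ENNReal.ofReal_le_ofReal ?_
    have := one_add_mul_le_pow (a := -(ε * (1 / (n:ℝ)))) (by linarith) n
    calc 1 - ε = 1 + n * (-(ε * (1 / (n:ℝ)))) := by field_simp; ring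
      _ ≤ _ := this
      _ = _ := by ring
  have key2 : ∀ ε : ℝ, 0 < ε → ε < 1 → ENNReal.ofReal (1 - ε) * μ (φ ⁻¹' U) ≤ μ U := by
    intro ε hε hε1
    obtain ⟨n₀, hn₀⟩ := eventually_atTop.1 (key ε hε hε1)
    let T : ℕ → Set E := fun m => ⋂ n ≥ m, (fun x => x + (1 / (n:ℝ)) • V x)^[n] ⁻¹' U
    have hmono : Monotone T := fun m m' hm => by
      intro x hx
      simp only [T, Set.mem_iInter] at hx ⊢
      exact fun n hn => hx n (hm.trans hn)
    have hsub : φ ⁻¹' U ⊆ ⋃ m, T m := by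
      intro x hx
      obtain ⟨m, hm⟩ := eventually_atTop.1 ((hφ x).eventually_mem (hU.mem_nhds hx))
      exact Set.mem_iUnion.2 ⟨m, by simpa [T] using hm⟩
    calc _ ≤ ENNReal.ofReal (1 - ε) * μ (⋃ m, T m) := by gcongr
      _ = ⨆ m, ENNReal.ofReal (1 - ε) * μ (T m) := by
        rw [hmono.measure_iUnion, ENNReal.mul_iSup]
      _ ≤ μ U := by
        refine iSup_le fun m => ?_
        refine le_trans ?_ (hn₀ (max m n₀) (le_max_right _ _))
        gcongr
        exact Set.biInter_subset_of_mem (s := {n | n ≥ m}) (le_max_left m n₀)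
  have hl : Tendsto (fun n : ℕ => ENNReal.ofReal (1 - 1 / ((n:ℝ) + 2)) * μ (φ ⁻¹' U)) atTop
      (𝓝 (1 * μ (φ ⁻¹' U))) := by
    refine ENNReal.Tendsto.mul_const ?_ (Or.inl one_ne_zero)
    rw [← ENNReal.ofReal_one]
    refine ENNReal.tendsto_ofReal ?_
    have : Tendsto (fun n : ℕ => 1 / ((n:ℝ) + 2)) atTop (𝓝 0) := by
      have := (tendsto_one_div_atTop_nhds_zero_nat (𝕜 := ℝ)).comp (tendsto_add_atTop_nat 2)
      refine this.congr fun n => by simp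
    simpa using this.const_sub 1
  rw [one_mul] at hl
  refine le_of_tendsto' hl fun n => key2 _ (by positivity) ?_
  rw [div_lt_one (by positivity)]
  have : (0:ℝ) ≤ n := by positivity
  linarith

/-- Liouville's theorem. -/
lemma aux_liouville {V : E → E} {V' : E → E →L[ℝ] E} (hV' : ∀ x, HasFDerivAt V (V' x) x)
    (htr : ∀ x, LinearMap.trace ℝ E (V' x : E →ₗ[ℝ] E) = 0)
    {K : NNReal} (hV : LipschitzWith K V) {Φ : ℝ → E → E} (h0 : ∀ x, Φ 0 x = x)
    (hΦ : ∀ x s, HasDerivAt (fun s' => Φ s' x) (V (Φ s x)) s) (s : ℝ) :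
    MeasurePreserving (Φ s) μ μ ∧ MeasurableEmbedding (Φ s) := by
  have hconv : ∀ s x, Tendsto (fun n : ℕ => ((fun x => x + (1 / (n:ℝ)) • (s • V x))^[n]) x)
      atTop (𝓝 (Φ s x)) := by
    intro s x
    have hL : LipschitzWith (‖s‖₊ * K) (fun x => s • V x) := (lipschitzWith_smul s).comp hV
    have := aux_euler hL (u := fun t => Φ (t * s) x) (fun t => by
      have h1 := (hΦ x (t * s)).scomp t (h := fun t => t * s) (hasDerivAt_mul_const s)
      exact h1)
    simpa [h0] using this
  have hmeas : ∀ s, Measurable (Φ s) := by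
    intro s
    refine measurable_of_tendsto_metrizable (fun n => ?_) (tendsto_pi_nhds.2 (hconv s))
    refine Measurable.iterate (Continuous.measurable ?_) n
    exact continuous_id.add ((hV.continuous.const_smul _).const_smul _)
  have hinv : ∀ s x, Φ (-s) (Φ s x) = x := by
    intro s x
    have := ODE_solution_unique_univ (v := fun _ => V) (s := fun _ => Set.univ) (K := K)
      (f := fun t => Φ t (Φ s x)) (g := fun t => Φ (t + s) x) (t₀ := 0)
      (fun _ => hV.lipschitzOnWith) (fun t => ⟨hΦ _ t, trivial⟩)
      (fun t => ⟨(hΦ x (t + s)).comp_add_const t s, trivial⟩) (by simp [h0])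
    have := congrFun this (-s)
    simpa [h0] using this
  have hopen : ∀ s (U : Set E), IsOpen U → μ (Φ s ⁻¹' U) ≤ μ U := by
    intro s U hU
    have hL : LipschitzWith (‖s‖₊ * K) (fun x => s • V x) := (lipschitzWith_smul s).comp hV
    exact aux_open μ (V := fun x => s • V x) (V' := fun x => s • V' x)
      (fun x => (hV' x).const_smul s)
      (fun x => by rw [ContinuousLinearMap.toLinearMap_smul, map_smul, htr, smul_zero])
      hL (hconv s) hU
  have hle : ∀ s (S : Set E), μ (Φ s ⁻¹' S) ≤ μ S := by
    intro s S
    rw [S.measure_eq_iInf_isOpen μ]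
    refine le_iInf fun U => le_iInf fun hSU => le_iInf fun hU => ?_
    exact (measure_mono (Set.preimage_mono hSU)).trans (hopen s U hU)
  refine ⟨⟨hmeas s, ?_⟩, ?_⟩
  · ext S hS
    rw [Measure.map_apply (hmeas s) hS]
    refine le_antisymm (hle s S) ?_
    have := hle (-s) (Φ s ⁻¹' S)
    rw [← Set.preimage_comp] at this
    have e : Φ s ∘ Φ (-s) = id := by
      funext x; simpa using hinv (-s) x
    rwa [e] at this
  · exact (MeasurableEquiv.mk ⟨Φ s, Φ (-s), hinv s, fun x => by simpa using hinv (-s) x⟩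
      (hmeas s) (hmeas (-s))).measurableEmbedding
end gen

/-- With `A ∈ C²(ℝ^N × ℝ; ℝ^N)`, `a := ∂_ξ A`, `b := div_x A` globally
Lipschitz, `b(x,0) = 0` for all `x`, and `Φ_s` the global flow of
`V(x,ξ) := (a(x,ξ), -b(x,ξ))`, for every `g ∈ L¹(ℝ^{N+1})` and every `s ∈ ℝ`:
`∫ g(Φ_s(y,η)) sgn(η) dy dη = ∫ g(y,η) sgn(η) dy dη`. -/
theorem stmt5 (N : ℕ) (hN : 1 ≤ N)
    (A : (Fin N → ℝ) × ℝ → (Fin N → ℝ)) (hA : ContDiff ℝ 2 A)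
    (a : (Fin N → ℝ) × ℝ → (Fin N → ℝ))
    (ha : ∀ (p : (Fin N → ℝ) × ℝ) (i : Fin N),
      HasDerivAt (fun ξ : ℝ => A (p.1, ξ) i) (a p i) p.2)
    (b : (Fin N → ℝ) × ℝ → ℝ)
    (hb : ∀ p : (Fin N → ℝ) × ℝ,
      b p = ∑ i : Fin N, fderiv ℝ (fun y : Fin N → ℝ => A (y, p.2) i) p.1 (Pi.single i 1))
    (K : NNReal) (haLip : LipschitzWith K a) (hbLip : LipschitzWith K b)
    (hb0 : ∀ x : Fin N → ℝ, b (x, 0) = 0)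
    (Φ : ℝ → ((Fin N → ℝ) × ℝ) → ((Fin N → ℝ) × ℝ))
    (hΦ0 : ∀ p : (Fin N → ℝ) × ℝ, Φ 0 p = p)
    (hΦ : ∀ (p : (Fin N → ℝ) × ℝ) (s : ℝ),
      HasDerivAt (fun s' : ℝ => Φ s' p) (a (Φ s p), -(b (Φ s p))) s) :
    ∀ g : ((Fin N → ℝ) × ℝ) → ℝ, Integrable g → ∀ s : ℝ,
      ∫ p : (Fin N → ℝ) × ℝ, g (Φ s p) * Real.sign p.2
        = ∫ p : (Fin N → ℝ) × ℝ, g p * Real.sign p.2 := by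
  intro g _ s
  let V : (Fin N → ℝ) × ℝ → (Fin N → ℝ) × ℝ := fun p => (a p, -(b p))
  have hAd : Differentiable ℝ A := hA.differentiable (by norm_num)
  have hA' : Differentiable ℝ (fderiv ℝ A) :=
    (hA.fderiv_right (m := 1) (by norm_num)).differentiable (by norm_num)
  let D2 := fun p => fderiv ℝ (fderiv ℝ A) p
  have haeq : a = fun p => fderiv ℝ A p (0, 1) := by
    funext p
    ext i
    have h1 : HasDerivAt (fun ξ : ℝ => (p.1, ξ)) ((0 : Fin N → ℝ), (1:ℝ)) p.2 :=
      (hasDerivAt_const _ _).prodMk (hasDerivAt_id _)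
    have h2 := ((hAd (p.1, p.2)).hasFDerivAt).comp_hasDerivAt p.2 h1
    exact (ha p i).unique ((hasDerivAt_pi.1 h2) i)
  have hbeq : b = fun p => ∑ i : Fin N, fderiv ℝ A p (Pi.single i 1, 0) i := by
    funext p
    rw [hb]
    refine Finset.sum_congr rfl fun i _ => ?_
    have h1 : HasFDerivAt (fun y : Fin N → ℝ => (y, p.2))
        (ContinuousLinearMap.inl ℝ (Fin N → ℝ) ℝ) p.1 := hasFDerivAt_prodMk_left _ _
    have h2 := ((hAd (p.1, p.2)).hasFDerivAt).comp p.1 h1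
    have h3 := (hasFDerivAt_pi'.1 h2) i
    have h4 := h3.fderiv
    simp only [Function.comp_def] at h4
    rw [h4]
    simp
  let a' : (Fin N → ℝ) × ℝ → ((Fin N → ℝ) × ℝ →L[ℝ] (Fin N → ℝ)) := fun p =>
    (ContinuousLinearMap.apply ℝ (Fin N → ℝ) ((0 : Fin N → ℝ), (1:ℝ))).comp (D2 p)
  let b' : (Fin N → ℝ) × ℝ → ((Fin N → ℝ) × ℝ →L[ℝ] ℝ) := fun p =>
    ∑ i : Fin N, (ContinuousLinearMap.proj i).comp
      ((ContinuousLinearMap.apply ℝ (Fin N → ℝ) ((Pi.single i 1 : Fin N → ℝ), (0:ℝ))).comp (D2 p))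
  have hda : ∀ p, HasFDerivAt a (a' p) p := by
    intro p
    rw [haeq]
    exact (ContinuousLinearMap.hasFDerivAt (ContinuousLinearMap.apply ℝ (Fin N → ℝ)
      ((0 : Fin N → ℝ), (1:ℝ)))).comp p (hA' p).hasFDerivAt
  have hdb : ∀ p, HasFDerivAt b (b' p) p := by
    intro p
    rw [hbeq]
    refine HasFDerivAt.fun_sum fun i _ => ?_
    exact (ContinuousLinearMap.hasFDerivAt (ContinuousLinearMap.proj (R := ℝ) (φ := fun _ : Fin N => ℝ) i)).comp p
      ((ContinuousLinearMap.hasFDerivAt (ContinuousLinearMap.apply ℝ (Fin N → ℝ)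
        ((Pi.single i 1 : Fin N → ℝ), (0:ℝ)))).comp p (hA' p).hasFDerivAt)
  have hsymm : ∀ p v w, D2 p v w = D2 p w v := fun p =>
    (hA.contDiffAt (x := p)).isSymmSndFDerivAt (by simp)
  have htr : ∀ p, LinearMap.trace ℝ _ (((a' p).prod (-(b' p)) :
      ((Fin N → ℝ) × ℝ →L[ℝ] (Fin N → ℝ) × ℝ)) : (Fin N → ℝ) × ℝ →ₗ[ℝ] (Fin N → ℝ) × ℝ) = 0 := by
    intro p
    classical
    rw [LinearMap.trace_eq_matrix_trace ℝ
      ((Pi.basisFun ℝ (Fin N)).prod (Module.Basis.singleton Unit ℝ))]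
    simp only [Matrix.trace, Matrix.diag, LinearMap.toMatrix_apply, Fintype.sum_sum_type]
    simp [a', b', hsymm p (0, 1)]
  have hVL : LipschitzWith (max K K) V := haLip.prodMk hbLip.neg
  haveI : (volume : Measure ((Fin N → ℝ) × ℝ)).IsAddHaarMeasure := by
    rw [Measure.volume_eq_prod]; infer_instance
  obtain ⟨hmp, hme⟩ := aux_liouville (volume : Measure ((Fin N → ℝ) × ℝ)) (V := V)
    (fun p => (hda p).prodMk (hdb p).neg) htr hVL hΦ0 hΦ s
  have hsnd : ∀ p t, HasDerivAt (fun t => (Φ t p).2) (-(b (Φ t p))) t := fun p t => (hΦ p t).snd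
  have hzero : ∀ p t₀, (Φ t₀ p).2 = 0 → ∀ t, (Φ t p).2 = 0 := by
    intro p t₀ h t
    have := ODE_solution_unique_univ (v := fun t z => -(b ((Φ t p).1, z)))
      (s := fun _ => Set.univ) (K := K)
      (f := fun t => (Φ t p).2) (g := fun _ => (0:ℝ)) (t₀ := t₀)
      (fun t => (LipschitzWith.of_dist_le_mul fun x y => by
        have := hbLip.dist_le_mul ((Φ t p).1, x) ((Φ t p).1, y)
        rw [dist_prod_same_left] at this
        rwa [dist_neg_neg]).lipschitzOnWith)
      (fun t => ⟨hsnd p t, trivial⟩)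
      (fun t => ⟨by simpa [hb0] using hasDerivAt_const t (0:ℝ), trivial⟩) h
    exact congrFun this t
  have hcont : ∀ p, Continuous (fun t => (Φ t p).2) := fun p =>
    continuous_iff_continuousAt.2 fun t => (hsnd p t).continuousAt
  have hsign : ∀ p, Real.sign (Φ s p).2 = Real.sign p.2 := by
    intro p
    have hp : (Φ 0 p).2 = p.2 := by rw [hΦ0]
    rcases lt_trichotomy p.2 0 with h | h | h
    · have : (Φ s p).2 < 0 := by
        by_contra! hc
        obtain ⟨t, ht⟩ := mem_range_of_exists_le_of_exists_ge (hcont p) (c := 0)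
          ⟨0, by linarith⟩ ⟨s, hc⟩
        have := hzero p t ht 0
        linarith
      rw [Real.sign_of_neg h, Real.sign_of_neg this]
    · rw [hzero p 0 (by rw [hp, h]) s, h]
    · have : 0 < (Φ s p).2 := by
        by_contra! hc
        obtain ⟨t, ht⟩ := mem_range_of_exists_le_of_exists_ge (hcont p) (c := 0)
          ⟨s, hc⟩ ⟨0, by linarith⟩
        have := hzero p t ht 0
        linarith
      rw [Real.sign_of_pos h, Real.sign_of_pos this]
  have := hmp.integral_comp hme (fun p => g p * Real.sign p.2)
  simpa only [hsign] using this
end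

section
/- There exists τ > 0, depending only on N and the uniform bound K on the first-order partial derivatives of a and b, such that for every constant M ∈ ℝ there is a bounded C¹ function U : ℝ^N × [−τ, τ] → ℝ with U(x,0) = M for all x, solving the conservation law pointwise: ∂_t U(x,t) + b(x, U(x,t)) + a(x, U(x,t)) · D_x U(x,t) = 0 (equivalently, ∂_t U + div_x[A(x,U(x,t))] = 0) for all (x,t) ∈ ℝ^N × [−τ, τ]. -/
set_option linter.unusedSectionVars false

open Set Filter Topology unitInterval

section helpers

variable {E F : Type*} [NormedAddCommGroup E] [NormedSpace ℝ E]
  [NormedAddCommGroup F] [NormedSpace ℝ F]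

noncomputable def evalBil : C(I, E →L[ℝ] F) →L[ℝ] C(I, E) →L[ℝ] C(I, F) :=
  LinearMap.mkContinuous₂
    (LinearMap.mk₂ ℝ (fun (T : C(I, E →L[ℝ] F)) (h : C(I, E)) =>
      (⟨fun s => T s (h s), by fun_prop⟩ : C(I, F)))
      (by intros; ext; simp) (by intros; ext; simp) (by intros; ext; simp)
      (by intros; ext; simp)) 1 (by
      intro T h
      rw [ContinuousMap.norm_le _ (by positivity)]
      intro s
      simp only [LinearMap.mk₂_apply, ContinuousMap.coe_mk, one_mul]
      exact ((T s).le_opNorm _).trans (by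
        gcongr
        · exact T.norm_coe_le_norm s
        · exact h.norm_coe_le_norm s))

theorem evalBil_apply (T : C(I, E →L[ℝ] F)) (h : C(I, E)) (s : I) :
    evalBil T h s = T s (h s) := rfl

theorem comp_unif {G : Type*} [NormedAddCommGroup G] (D : C(E, G)) (γ : C(I, E))
    (ε : ℝ) (hε : 0 < ε) :
    ∃ δ > 0, ∀ η : C(I, E), dist η γ < δ → ∀ s, ‖D (η s) - D (γ s)‖ ≤ ε := by
  obtain ⟨δ, hδ, H⟩ := Metric.continuous_iff.1 (ContinuousMap.continuous_postcomp (X := I) D) γ ε hε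
  refine ⟨δ, hδ, fun η h s => ?_⟩
  have h1 := H η h
  rw [dist_eq_norm] at h1
  exact (ContinuousMap.norm_coe_le_norm _ s).trans h1.le

theorem nemytskii (f : E → F) (hf : ContDiff ℝ 1 f) (hc : Continuous f) :
    ContDiff ℝ 1 (fun γ : C(I, E) => (⟨f, hc⟩ : C(E, F)).comp γ) := by
  have hc' : Continuous (fderiv ℝ f) := hf.continuous_fderiv (by simp)
  have hd : ∀ x, HasFDerivAt f (fderiv ℝ f x) x :=
    fun x => (hf.differentiable (by simp) x).hasFDerivAt
  set D : C(E, E →L[ℝ] F) := ⟨fderiv ℝ f, hc'⟩ with hD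
  have hDc : Continuous (fun γ : C(I, E) => D.comp γ) := ContinuousMap.continuous_postcomp D
  rw [contDiff_one_iff_hasFDerivAt]
  refine ⟨fun γ => evalBil (D.comp γ), evalBil.continuous.comp hDc, ?_⟩
  intro γ
  rw [hasFDerivAt_iff_isLittleO_nhds_zero, Asymptotics.isLittleO_iff]
  intro ε hε
  obtain ⟨δ, hδ, H⟩ := comp_unif D γ ε hε
  filter_upwards [Metric.ball_mem_nhds (0 : C(I, E)) hδ] with h hh
  rw [mem_ball_zero_iff] at hh
  rw [ContinuousMap.norm_le _ (by positivity)]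
  intro s
  have key : ∀ z ∈ segment ℝ (γ s) (γ s + h s), ‖fderiv ℝ f z - fderiv ℝ f (γ s)‖ ≤ ε := by
    intro z hz
    rw [segment_eq_image'] at hz
    obtain ⟨θ, hθ, rfl⟩ := hz
    have h1 := H (γ + θ • h) (by
      rw [dist_eq_norm]
      simp only [add_sub_cancel_left, norm_smul, Real.norm_eq_abs, abs_of_nonneg hθ.1]
      exact (mul_le_of_le_one_left (norm_nonneg _) hθ.2).trans_lt hh) s
    simpa [hD] using h1
  have := (convex_segment (𝕜 := ℝ) (γ s) (γ s + h s)).norm_image_sub_le_of_norm_hasFDerivWithin_le'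
    (fun z _ => (hd z).hasFDerivWithinAt) key (left_mem_segment ℝ _ _) (right_mem_segment ℝ _ _)
  simp only [add_sub_cancel_left] at this
  refine le_trans ?_ (this.trans (by gcongr; exact h.norm_coe_le_norm s))
  simp [evalBil_apply, hD]

theorem fixedPoint_C1 {P X : Type*} [NormedAddCommGroup P] [NormedSpace ℝ P] [CompleteSpace P]
    [NormedAddCommGroup X] [NormedSpace ℝ X] [CompleteSpace X]
    (Φ : P × X → X) (hΦ : ContDiff ℝ 1 Φ) (D : Set P) (hD : IsOpen D)
    (hL : ∀ p ∈ D, LipschitzWith (1/2) (fun γ => Φ (p, γ))) :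
    ∃ g : P → X, (∀ p ∈ D, Φ (p, g p) = g p) ∧ (∀ p ∈ D, ∀ γ, Φ (p, γ) = γ → γ = g p) ∧
      ∀ p ∈ D, ContDiffAt ℝ 1 g p := by
  have hC : ∀ p ∈ D, ContractingWith (1/2) (fun γ => Φ (p, γ)) := fun p hp =>
    ⟨by norm_num, hL p hp⟩
  classical
  set g : P → X := fun p => if hp : p ∈ D then
    ContractingWith.fixedPoint (fun γ => Φ (p, γ)) (hC p hp) else 0 with hg
  have h1 : ∀ p ∈ D, Φ (p, g p) = g p := by
    intro p hp
    simp only [hg, hp, dif_pos]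
    exact (hC p hp).fixedPoint_isFixedPt
  have h2 : ∀ p ∈ D, ∀ γ, Φ (p, γ) = γ → γ = g p := by
    intro p hp γ h
    simp only [hg, hp, dif_pos]
    exact (hC p hp).fixedPoint_unique h
  refine ⟨g, h1, h2, ?_⟩
  intro p hp
  set f : P × X → X := fun q => q.2 - Φ q with hf
  have hfc : ContDiff ℝ 1 f := contDiff_snd.sub hΦ
  have hder : fderiv ℝ f (p, g p) ∘L .inr ℝ P X =
      1 - fderiv ℝ Φ (p, g p) ∘L .inr ℝ P X := by
    have : fderiv ℝ f (p, g p) = ContinuousLinearMap.snd ℝ P X - fderiv ℝ Φ (p, g p) :=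
      (hasFDerivAt_snd.sub (hΦ.differentiable (by simp) _).hasFDerivAt).fderiv
    rw [this]
    ext v
    simp
  have hn : ‖fderiv ℝ Φ (p, g p) ∘L .inr ℝ P X‖ < 1 := by
    have h3 : HasFDerivAt (fun γ => Φ (p, γ)) (fderiv ℝ Φ (p, g p) ∘L .inr ℝ P X) (g p) :=
      (hΦ.differentiable (by simp) (p, g p)).hasFDerivAt.comp (g p) (hasFDerivAt_prodMk_right p (g p))
    have := h3.le_of_lipschitz (hL p hp)
    refine this.trans_lt (by norm_num)
  have hinv : (fderiv ℝ f (p, g p) ∘L .inr ℝ P X).IsInvertible := by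
    rw [hder]
    exact ⟨ContinuousLinearEquiv.ofUnit (Units.oneSub _ hn), rfl⟩
  have cdf : ContDiffAt ℝ 1 f (p, g p) := hfc.contDiffAt
  refine (cdf.contDiffAt_implicitFunction (by simp) hinv).congr_of_eventuallyEq ?_
  filter_upwards [cdf.eventually_apply_implicitFunction (by simp) hinv, hD.mem_nhds hp] with q hq hqD
  symm
  apply h2 q hqD
  have : f (p, g p) = 0 := by simp [hf, h1 p hp]
  rw [this] at hq
  exact (sub_eq_zero.1 hq).symm

end helpers

section integ
variable {E F : Type*} [NormedAddCommGroup E] [NormedSpace ℝ E] [CompleteSpace E]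
  [NormedAddCommGroup F] [NormedSpace ℝ F] [CompleteSpace F]

noncomputable def ext01 (h : C(I, E)) (r : ℝ) : E := h (projIcc 0 1 zero_le_one r)

theorem ext01_cont (h : C(I, E)) : Continuous (ext01 h) :=
  h.continuous.comp continuous_projIcc

theorem ext01_norm (h : C(I, E)) (r : ℝ) : ‖ext01 h r‖ ≤ ‖h‖ := h.norm_coe_le_norm _

noncomputable def intOp (c : I) : C(I, E) →L[ℝ] C(I, E) :=
  LinearMap.mkContinuous
    { toFun := fun h => (⟨fun s => ∫ r in (c : ℝ)..s, ext01 h r, 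
        (intervalIntegral.continuous_primitive
          (fun _ _ => (ext01_cont h).intervalIntegrable _ _) _).comp continuous_subtype_val⟩ : C(I, E))
      map_add' := by
        intro h k
        ext s
        exact intervalIntegral.integral_add ((ext01_cont h).intervalIntegrable _ _)
          ((ext01_cont k).intervalIntegrable _ _)
      map_smul' := by
        intro m h
        ext s
        exact intervalIntegral.integral_smul m _ } 1 (by
    intro h
    rw [ContinuousMap.norm_le _ (by positivity)]
    intro s
    refine (intervalIntegral.norm_integral_le_of_norm_le_const
      (fun r _ => ext01_norm h r)).trans ?_
    rw [one_mul]
    refine mul_le_of_le_one_right (norm_nonneg _) ?_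
    have h1 := s.2.1
    have h2 := s.2.2
    have h3 := c.2.1
    have h4 := c.2.2
    rw [abs_le]
    constructor <;> linarith)

theorem intOp_apply (c : I) (h : C(I, E)) (s : I) :
    intOp c h s = ∫ r in (c : ℝ)..s, ext01 h r := rfl

theorem intOp_norm (c : I) (h : C(I, E)) : ‖intOp c h‖ ≤ ‖h‖ := by
  have := (intOp (E := E) c).le_of_opNorm_le (LinearMap.mkContinuous_norm_le _ zero_le_one _) h
  simpa using this

noncomputable def pairOp : C(I, E) × C(I, F) →L[ℝ] C(I, E × F) :=
  LinearMap.mkContinuous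
    { toFun := fun h => h.1.prodMk h.2
      map_add' := by intros; rfl
      map_smul' := by intros; rfl } 1 (by
    intro h
    rw [ContinuousMap.norm_le _ (by positivity)]
    intro s
    rw [one_mul]
    exact max_le_max (h.1.norm_coe_le_norm s) (h.2.norm_coe_le_norm s))

theorem pairOp_norm (h : C(I, E) × C(I, F)) : ‖pairOp h‖ ≤ ‖h‖ := by
  have := (pairOp (E := E) (F := F)).le_of_opNorm_le
    (LinearMap.mkContinuous_norm_le _ zero_le_one _) h
  simpa using this

end integ

section core
variable {V : Type*} [NormedAddCommGroup V] [NormedSpace ℝ V] [CompleteSpace V]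

noncomputable def constOp : V →L[ℝ] C(I, V) :=
  LinearMap.mkContinuous
    { toFun := fun v => ContinuousMap.const I v
      map_add' := by intros; rfl
      map_smul' := by intros; rfl } 1 (by
    intro v
    rw [ContinuousMap.norm_le _ (by positivity)]
    intro s
    rw [one_mul]
    exact le_refl ‖v‖)

theorem constOp_apply (v : V) (s : I) : constOp v s = v := rfl

noncomputable def PhiMap (a : C(V × ℝ, V)) (b : C(V × ℝ, ℝ)) (M : ℝ) :
    (V × ℝ) × C(I, V × ℝ) → C(I, V × ℝ) := fun q =>
  constOp (q.1.1, M) + q.1.2 • pairOp (intOp 1 (a.comp q.2), - intOp 0 (b.comp q.2))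

theorem PhiMap_apply (a : C(V × ℝ, V)) (b : C(V × ℝ, ℝ)) (M : ℝ) (x : V) (t : ℝ)
    (γ : C(I, V × ℝ)) (s : I) : PhiMap a b M ((x, t), γ) s =
    (x + t • ∫ r in (1:ℝ)..s, a (ext01 γ r), M - t * ∫ r in (0:ℝ)..s, b (ext01 γ r)) := by
  have h : PhiMap a b M ((x, t), γ) s =
    (x + t • ∫ r in (1:ℝ)..s, a (ext01 γ r), M + t * -∫ r in (0:ℝ)..s, b (ext01 γ r)) := rfl
  rw [h]
  ring_nf

theorem PhiMap_contDiff (a : C(V × ℝ, V)) (b : C(V × ℝ, ℝ)) (M : ℝ)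
    (ha : ContDiff ℝ 1 a) (hb : ContDiff ℝ 1 b) : ContDiff ℝ 1 (PhiMap a b M) := by
  have h1 : ContDiff ℝ 1 (fun γ : C(I, V × ℝ) => a.comp γ) := nemytskii a ha a.continuous
  have h2 : ContDiff ℝ 1 (fun γ : C(I, V × ℝ) => b.comp γ) := nemytskii b hb b.continuous
  unfold PhiMap
  have h3 : ContDiff ℝ 1 (fun q : (V × ℝ) × C(I, V × ℝ) => a.comp q.2) := h1.comp contDiff_snd
  have h4 : ContDiff ℝ 1 (fun q : (V × ℝ) × C(I, V × ℝ) => b.comp q.2) := h2.comp contDiff_snd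
  have h5 := (intOp (E := V) 1).contDiff.comp h3
  have h6 := ((intOp (E := ℝ) 0).contDiff.comp h4).neg
  have h7 := (pairOp (E := V) (F := ℝ)).contDiff.comp (h5.prodMk h6)
  have h8 : ContDiff ℝ 1 (fun q : (V × ℝ) × C(I, V × ℝ) => (constOp (q.1.1, M) : C(I, V × ℝ))) :=
    (constOp (V := V × ℝ)).contDiff.comp ((contDiff_fst.comp contDiff_fst).prodMk contDiff_const)
  exact h8.add ((contDiff_snd.comp contDiff_fst).smul h7)

theorem PhiMap_lip (a : C(V × ℝ, V)) (b : C(V × ℝ, ℝ)) (M K : ℝ) (hK : 0 < K)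
    (ha : ∀ p q, ‖a p - a q‖ ≤ K * ‖p - q‖) (hb : ∀ p q, ‖b p - b q‖ ≤ K * ‖p - q‖)
    (x : V) (t : ℝ) (ht : |t| * K ≤ 1 / 2) :
    LipschitzWith (1/2) (fun γ => PhiMap a b M ((x, t), γ)) := by
  apply LipschitzWith.of_dist_le_mul
  intro γ η
  rw [dist_eq_norm, dist_eq_norm]
  have e : PhiMap a b M ((x, t), γ) - PhiMap a b M ((x, t), η) =
      t • pairOp (intOp 1 (a.comp γ - a.comp η), - intOp 0 (b.comp γ - b.comp η)) := by
    simp only [PhiMap, add_sub_add_left_eq_sub, ← smul_sub, ← map_sub]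
    congr 2
    simp [map_sub]
    abel
  have n1 : ‖a.comp γ - a.comp η‖ ≤ K * ‖γ - η‖ := by
    rw [ContinuousMap.norm_le _ (by positivity)]
    intro s
    exact (ha _ _).trans (by gcongr; exact (γ - η).norm_coe_le_norm s)
  have n2 : ‖b.comp γ - b.comp η‖ ≤ K * ‖γ - η‖ := by
    rw [ContinuousMap.norm_le _ (by positivity)]
    intro s
    exact (hb _ _).trans (by gcongr; exact (γ - η).norm_coe_le_norm s)
  have n3 : ‖pairOp (intOp 1 (a.comp γ - a.comp η), - intOp 0 (b.comp γ - b.comp η))‖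
      ≤ K * ‖γ - η‖ := by
    refine (pairOp_norm _).trans (max_le ((intOp_norm _ _).trans n1) ?_)
    rw [norm_neg]
    exact (intOp_norm _ _).trans n2
  rw [e, norm_smul, Real.norm_eq_abs]
  calc |t| * _ ≤ |t| * (K * ‖γ - η‖) := by gcongr
    _ = (|t| * K) * ‖γ - η‖ := by ring
    _ ≤ (1/2) * ‖γ - η‖ := by gcongr
    _ = _ := by simp

theorem scale_fix (a : C(V × ℝ, V)) (b : C(V × ℝ, ℝ)) (M : ℝ) (x : V) (t : ℝ)
    (γ : C(I, V × ℝ)) (h : PhiMap a b M ((x, t), γ) = γ) (ρ : I) :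
    PhiMap a b M (((γ ρ).1, ρ * t), γ.comp ⟨fun s => ρ * s, by fun_prop⟩) =
      γ.comp ⟨fun s => ρ * s, by fun_prop⟩ := by
  have hs : ∀ s : I, γ s = (x + t • ∫ r in (1:ℝ)..s, a (ext01 γ r),
      M - t * ∫ r in (0:ℝ)..s, b (ext01 γ r)) := fun s => by
    rw [← PhiMap_apply, h]
  have hca : Continuous (fun r => a (ext01 γ r)) := a.continuous.comp (ext01_cont γ)
  have hcb : Continuous (fun r => b (ext01 γ r)) := b.continuous.comp (ext01_cont γ)
  have he : ∀ r ∈ Icc (0:ℝ) 1, ext01 (γ.comp ⟨fun s => ρ * s, by fun_prop⟩) r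
      = ext01 γ (ρ * r) := by
    intro r hr
    have h2 : (ρ : ℝ) * r ∈ Icc (0:ℝ) 1 :=
      ⟨mul_nonneg ρ.2.1 hr.1, mul_le_one₀ ρ.2.2 hr.1 hr.2⟩
    simp only [ext01, projIcc_of_mem zero_le_one hr, projIcc_of_mem zero_le_one h2]
    rfl
  ext1 s
  rw [PhiMap_apply]
  have i1 : ∫ r in (1:ℝ)..s, a (ext01 (γ.comp ⟨fun s => ρ * s, by fun_prop⟩) r)
      = ∫ r in (1:ℝ)..s, a (ext01 γ (ρ * r)) := by
    apply intervalIntegral.integral_congr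
    intro r hr
    rw [uIcc_of_ge s.2.2] at hr
    simp only
    rw [he r ⟨s.2.1.trans hr.1, hr.2⟩]
  have i2 : ∫ r in (0:ℝ)..s, b (ext01 (γ.comp ⟨fun s => ρ * s, by fun_prop⟩) r)
      = ∫ r in (0:ℝ)..s, b (ext01 γ (ρ * r)) := by
    apply intervalIntegral.integral_congr
    intro r hr
    rw [uIcc_of_le s.2.1] at hr
    simp only
    rw [he r ⟨hr.1, hr.2.trans s.2.2⟩]
  have j1 : (ρ : ℝ) • ∫ r in (1:ℝ)..s, a (ext01 γ (ρ * r)) =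
      ∫ r in (ρ:ℝ)..(ρ * s : ℝ), a (ext01 γ r) := by
    have := intervalIntegral.smul_integral_comp_mul_left (a := 1) (b := (s:ℝ))
      (fun r => a (ext01 γ r)) (ρ : ℝ)
    simpa using this
  have j2 : (ρ : ℝ) • ∫ r in (0:ℝ)..s, b (ext01 γ (ρ * r)) =
      ∫ r in (0:ℝ)..(ρ * s : ℝ), b (ext01 γ r) := by
    have := intervalIntegral.smul_integral_comp_mul_left (a := 0) (b := (s:ℝ))
      (fun r => b (ext01 γ r)) (ρ : ℝ)
    simpa using this
  rw [i1, i2]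
  have k1 : (ρ * t : ℝ) • ∫ r in (1:ℝ)..s, a (ext01 γ (ρ * r)) =
      t • ∫ r in (ρ:ℝ)..(ρ * s : ℝ), a (ext01 γ r) := by
    rw [← j1, smul_smul, mul_comm]
  have k2 : (ρ * t : ℝ) * ∫ r in (0:ℝ)..s, b (ext01 γ (ρ * r)) =
      t * ∫ r in (0:ℝ)..(ρ * s : ℝ), b (ext01 γ r) := by
    rw [← j2, smul_eq_mul]; ring
  rw [k1, k2]
  change _ = γ (ρ * s)
  rw [hs (ρ * s), hs ρ]
  refine Prod.ext ?_ rfl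
  simp only
  rw [add_assoc, ← smul_add, intervalIntegral.integral_add_adjacent_intervals
    (hca.intervalIntegrable _ _) (hca.intervalIntegrable _ _)]
  rfl

theorem core (a : C(V × ℝ, V)) (b : C(V × ℝ, ℝ)) (M K : ℝ) (hK : 0 < K)
    (hac : ContDiff ℝ 1 a) (hbc : ContDiff ℝ 1 b)
    (ha : ∀ p q, ‖a p - a q‖ ≤ K * ‖p - q‖) (hb : ∀ p q, ‖b p - b q‖ ≤ K * ‖p - q‖)
    (hb0 : ∀ x, b (x, 0) = 0) :
    ∃ U : V × ℝ → ℝ, (∀ x, U (x, 0) = M) ∧ ∀ x t, |t| * K < 1 / 2 →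
      ContDiffAt ℝ 1 U (x, t) ∧ |U (x, t)| ≤ 2 * |M| ∧
      fderiv ℝ U (x, t) (a (x, U (x, t)), 1) + b (x, U (x, t)) = 0 := by
  set D : Set (V × ℝ) := {p | |p.2| * K < 1 / 2} with hDdef
  have hD : IsOpen D := isOpen_lt (by fun_prop) continuous_const
  obtain ⟨g, g1, g2, g3⟩ := fixedPoint_C1 (PhiMap a b M) (PhiMap_contDiff a b M hac hbc) D hD
    (fun p hp => PhiMap_lip a b M K hK ha hb p.1 p.2 (le_of_lt hp))
  have hs : ∀ x t, (x, t) ∈ D → ∀ s : I, g (x, t) s =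
      (x + t • ∫ r in (1:ℝ)..s, a (ext01 (g (x, t)) r),
      M - t * ∫ r in (0:ℝ)..s, b (ext01 (g (x, t)) r)) := fun x t h s => by
    rw [← PhiMap_apply, g1 _ h]
  set U : V × ℝ → ℝ := fun p => (g p 1).2 with hU
  have hUc : ∀ p ∈ D, ContDiffAt ℝ 1 U p := by
    intro p hp
    have e : U = fun p => (ContinuousLinearMap.snd ℝ V ℝ)
        (ContinuousMap.evalCLM ℝ (1 : I) (g p)) := rfl
    rw [e]
    exact (ContinuousLinearMap.contDiff _).contDiffAt.comp p
      ((ContinuousLinearMap.contDiff _).contDiffAt.comp p (g3 p hp))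
  have hg1 : ∀ x t, (x, t) ∈ D → g (x, t) 1 = (x, U (x, t)) := by
    intro x t h
    refine Prod.ext ?_ rfl
    rw [hs x t h 1]
    simp
  have hbd : ∀ x t, (x, t) ∈ D → |U (x, t)| ≤ 2 * |M| := by
    intro x t h
    set v : C(I, ℝ) := ContinuousMap.comp ⟨Prod.snd, continuous_snd⟩ (g (x, t)) with hv
    have hvs : ∀ s, v s = (g (x, t) s).2 := fun s => rfl
    have hbv : ∀ p : V × ℝ, ‖b p‖ ≤ K * |p.2| := by
      intro p
      have := hb p (p.1, 0)
      rw [hb0] at this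
      simpa [Prod.norm_def] using this
    have hle : ‖v‖ ≤ |M| + 1/2 * ‖v‖ := by
      rw [ContinuousMap.norm_le _ (by positivity)]
      intro s
      rw [hvs, hs x t h s]
      have hi : ‖∫ r in (0:ℝ)..s, b (ext01 (g (x, t)) r)‖ ≤ K * ‖v‖ := by
        refine (intervalIntegral.norm_integral_le_of_norm_le_const (C := K * ‖v‖) ?_).trans ?_
        · intro r _
          refine (hbv _).trans ?_
          gcongr
          exact v.norm_coe_le_norm (projIcc 0 1 zero_le_one r)
        · refine mul_le_of_le_one_right (by positivity) ?_
          rw [sub_zero, abs_of_nonneg s.2.1]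
          exact s.2.2
      have ht : |t| * K < 1 / 2 := h
      calc ‖M - t * ∫ r in (0:ℝ)..s, b (ext01 (g (x, t)) r)‖
          ≤ ‖M‖ + ‖t * ∫ r in (0:ℝ)..s, b (ext01 (g (x, t)) r)‖ := norm_sub_le _ _
        _ = |M| + |t| * ‖∫ r in (0:ℝ)..s, b (ext01 (g (x, t)) r)‖ := by rw [norm_mul]; rfl
        _ ≤ |M| + |t| * (K * ‖v‖) := by gcongr
        _ = |M| + (|t| * K) * ‖v‖ := by ring
        _ ≤ |M| + 1/2 * ‖v‖ := by gcongr
    have : |U (x, t)| ≤ ‖v‖ := v.norm_coe_le_norm 1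
    linarith
  have hne : ∀ x t, (x, t) ∈ D → t ≠ 0 →
      fderiv ℝ U (x, t) (a (x, U (x, t)), 1) + b (x, U (x, t)) = 0 := by
    intro x t h ht0
    set γ := g (x, t) with hγ
    have hca : Continuous (fun r => a (ext01 γ r)) := a.continuous.comp (ext01_cont γ)
    have hcb : Continuous (fun r => b (ext01 γ r)) := b.continuous.comp (ext01_cont γ)
    have he1 : ext01 γ 1 = (x, U (x, t)) := by
      rw [← hg1 x t h]
      simp only [ext01, projIcc_right]
      rfl
    have dX : HasDerivAt (fun ρ : ℝ => x + t • ∫ r in (1:ℝ)..ρ, a (ext01 γ r))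
        (t • a (x, U (x, t))) 1 := by
      have := intervalIntegral.integral_hasDerivAt_right (hca.intervalIntegrable 1 1)
        (hca.stronglyMeasurableAtFilter _ _) hca.continuousAt
      rw [he1] at this
      exact (this.const_smul t).const_add x
    have dV : HasDerivAt (fun ρ : ℝ => M - t * ∫ r in (0:ℝ)..ρ, b (ext01 γ r))
        (-(t * b (x, U (x, t)))) 1 := by
      have := intervalIntegral.integral_hasDerivAt_right (hcb.intervalIntegrable 0 1)
        (hcb.stronglyMeasurableAtFilter _ _) hcb.continuousAt
      rw [he1] at this
      exact (this.const_mul t).const_sub M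
    have dT : HasDerivAt (fun ρ : ℝ => ρ * t) t 1 := by
      simpa using (hasDerivAt_id (1:ℝ)).mul_const t
    have dU : HasFDerivAt U (fderiv ℝ U (x, t)) (x, t) :=
      ((hUc _ h).differentiableAt (by simp)).hasFDerivAt
    have dC : HasDerivAt (fun ρ : ℝ => U (x + t • ∫ r in (1:ℝ)..ρ, a (ext01 γ r), ρ * t))
        (fderiv ℝ U (x, t) (t • a (x, U (x, t)), t)) 1 := by
      have dU' : HasFDerivAt U (fderiv ℝ U (x, t))
          ((fun ρ : ℝ => (x + t • ∫ r in (1:ℝ)..ρ, a (ext01 γ r), ρ * t)) 1) := by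
        simpa using dU
      exact HasFDerivAt.comp_hasDerivAt (l := U) 1 dU' (dX.prodMk dT)
    have heq : ∀ ρ ∈ Icc (0:ℝ) 1, U (x + t • ∫ r in (1:ℝ)..ρ, a (ext01 γ r), ρ * t) =
        M - t * ∫ r in (0:ℝ)..ρ, b (ext01 γ r) := by
      intro ρ hρ
      have h1 := scale_fix a b M x t γ (g1 _ h) ⟨ρ, hρ⟩
      have hm : ((γ ⟨ρ, hρ⟩).1, ρ * t) ∈ D := by
        change |ρ * t| * K < 1 / 2
        have ht : |t| * K < 1 / 2 := h
        refine lt_of_le_of_lt ?_ ht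
        rw [abs_mul, abs_of_nonneg hρ.1]
        gcongr
        exact mul_le_of_le_one_left (abs_nonneg _) hρ.2
      have h2 := g2 _ hm _ h1
      have h3 := hs x t h ⟨ρ, hρ⟩
      have h4 : (x + t • ∫ r in (1:ℝ)..ρ, a (ext01 γ r)) = (γ ⟨ρ, hρ⟩).1 := by
        rw [hγ, h3]
      rw [h4]
      change (g ((γ ⟨ρ, hρ⟩).1, ρ * t) 1).2 = _
      rw [← h2]
      change (γ (⟨ρ, hρ⟩ * 1)).2 = _
      rw [mul_one, hγ, h3]
    have hu : UniqueDiffWithinAt ℝ (Icc (0:ℝ) 1) 1 :=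
      uniqueDiffOn_Icc zero_lt_one 1 (by simp)
    have hfin := hu.eq_deriv _ (dV.hasDerivWithinAt.congr heq (heq 1 (by simp)))
      (dC.hasDerivWithinAt)
    have e2 : ((t • a (x, U (x, t)), t) : V × ℝ) = t • (a (x, U (x, t)), 1) := by
      simp
    rw [e2, map_smul, smul_eq_mul] at hfin
    have : t * (fderiv ℝ U (x, t) (a (x, U (x, t)), 1) + b (x, U (x, t))) = 0 := by
      linarith
    exact (mul_eq_zero.1 this).resolve_left ht0
  have hD0 : ∀ x : V, (x, (0:ℝ)) ∈ D := by
    intro x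
    simp [hDdef]
  refine ⟨U, ?_, ?_⟩
  · intro x
    have := congrArg Prod.snd (hs x 0 (hD0 x) 1)
    simpa using this
  · intro x t ht
    refine ⟨hUc _ ht, hbd x t ht, ?_⟩
    by_cases h0 : t = 0
    · subst h0
      have hcont : ContinuousAt (fun s : ℝ => fderiv ℝ U (x, s) (a (x, U (x, s)), 1)
          + b (x, U (x, s))) 0 := by
        have hp : ContinuousAt (fun s : ℝ => (x, s)) 0 := by fun_prop
        have c1 : ContinuousAt (fun s : ℝ => U (x, s)) 0 :=
          ContinuousAt.comp (f := fun s : ℝ => (x, s)) (hUc _ ht).continuousAt hp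
        have c2 : ContinuousAt (fun s : ℝ => fderiv ℝ U (x, s)) 0 :=
          ContinuousAt.comp (f := fun s : ℝ => (x, s)) 
            ((hUc _ ht).fderiv_right (m := 0) (by simp)).continuousAt hp
        have c3 : ContinuousAt (fun s : ℝ => (x, U (x, s))) 0 := continuousAt_const.prodMk c1
        have c4 : ContinuousAt (fun s : ℝ => a (x, U (x, s))) 0 :=
          a.continuous.continuousAt.comp c3
        have c5 : ContinuousAt (fun s : ℝ => b (x, U (x, s))) 0 :=
          b.continuous.continuousAt.comp c3
        exact (c2.clm_apply (c4.prodMk continuousAt_const)).add c5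
      have hev : ∀ᶠ s in 𝓝[≠] (0:ℝ), fderiv ℝ U (x, s) (a (x, U (x, s)), 1)
          + b (x, U (x, s)) = 0 := by
        have hm : ∀ᶠ s in 𝓝 (0:ℝ), (x, s) ∈ D :=
          (Continuous.continuousAt (by fun_prop : Continuous (fun s : ℝ => (x, s)))).eventually
            (hD.mem_nhds ht)
        filter_upwards [hm.filter_mono nhdsWithin_le_nhds, self_mem_nhdsWithin] with s h1 h2
        exact hne x s h1 h2
      have l1 := hcont.tendsto.mono_left (nhdsWithin_le_nhds (s := {0}ᶜ))
      have l2 : Tendsto (fun s : ℝ => fderiv ℝ U (x, s) (a (x, U (x, s)), 1)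
          + b (x, U (x, s))) (𝓝[≠] (0:ℝ)) (𝓝 0) :=
        tendsto_const_nhds.congr' (hev.mono fun s hs => hs.symm)
      exact tendsto_nhds_unique l1 l2
    · exact hne x t ht h0

end core

theorem stmt14 (N : ℕ) (hN : 1 ≤ N) (K : ℝ) (hK : 0 < K) :
    ∃ τ : ℝ, 0 < τ ∧
      ∀ (A : (Fin N → ℝ) × ℝ → (Fin N → ℝ))
        (a : (Fin N → ℝ) × ℝ → (Fin N → ℝ)) (b : (Fin N → ℝ) × ℝ → ℝ),
        ContDiff ℝ 2 A →
        (∀ (p : (Fin N → ℝ) × ℝ) (i : Fin N),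
          HasDerivAt (fun ξ : ℝ => A (p.1, ξ) i) (a p i) p.2) →
        (∀ p : (Fin N → ℝ) × ℝ,
          b p = ∑ i : Fin N,
            fderiv ℝ (fun y : Fin N → ℝ => A (y, p.2) i) p.1 (Pi.single i 1)) →
        (∀ p : (Fin N → ℝ) × ℝ, ‖fderiv ℝ a p‖ ≤ K) →
        (∀ p : (Fin N → ℝ) × ℝ, ‖fderiv ℝ b p‖ ≤ K) →
        (∀ x : Fin N → ℝ, b (x, 0) = 0) →
        ∀ M : ℝ, ∃ U : (Fin N → ℝ) → ℝ → ℝ,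
          (∃ C : ℝ, ∀ (x : Fin N → ℝ) (t : ℝ), |t| ≤ τ → |U x t| ≤ C) ∧
          ContDiffOn ℝ 1 (fun q : (Fin N → ℝ) × ℝ => U q.1 q.2)
            (Set.univ ×ˢ Set.Icc (-τ) τ) ∧
          (∀ x : Fin N → ℝ, U x 0 = M) ∧
          (∀ (x : Fin N → ℝ) (t : ℝ), |t| ≤ τ →
            deriv (fun s : ℝ => U x s) t + b (x, U x t)
              + ∑ i : Fin N,
                  a (x, U x t) i * fderiv ℝ (fun y : Fin N → ℝ => U y t) x (Pi.single i 1)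
              = 0) := by
  refine ⟨1 / (4 * K), by positivity, ?_⟩
  intro A a b hA hAa hAb hKa hKb hb0 M
  have hAd : ∀ p, HasFDerivAt A (fderiv ℝ A p) p := fun p =>
    (hA.differentiable (by simp) p).hasFDerivAt
  have hA1 : ContDiff ℝ 1 (fderiv ℝ A) := hA.fderiv_right (by norm_num)
  have hac : ContDiff ℝ 1 a := by
    have e : a = fun p => fderiv ℝ A p (0, 1) := by
      funext p i
      refine (hAa p i).unique ?_
      have h1 : HasDerivAt (fun ξ : ℝ => (p.1, ξ)) ((0, 1) : (Fin N → ℝ) × ℝ) p.2 :=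
        (hasDerivAt_const _ _).prodMk (hasDerivAt_id _)
      have h2 := (hAd p).comp_hasDerivAt p.2 h1
      exact (hasDerivAt_pi.1 h2) i
    rw [e]
    exact hA1.clm_apply contDiff_const
  have hbc : ContDiff ℝ 1 b := by
    have e : b = fun p => ∑ i : Fin N, fderiv ℝ A p (Pi.single i 1, 0) i := by
      funext p
      rw [hAb p]
      refine Finset.sum_congr rfl fun i _ => ?_
      have h2 := HasFDerivAt.comp (f := fun y => (y, p.2)) p.1 (hAd p)
        (hasFDerivAt_prodMk_left (𝕜 := ℝ) p.1 p.2)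
      have h3 := (hasFDerivAt_pi'.1 h2 i).fderiv
      have h4 := congrArg (fun T => T (Pi.single i (1:ℝ))) h3
      simpa using h4
    rw [e]
    refine ContDiff.sum fun i _ => ?_
    exact contDiff_pi.1 (hA1.clm_apply contDiff_const) i
  have ha : ∀ p q, ‖a p - a q‖ ≤ K * ‖p - q‖ := fun p q =>
    convex_univ.norm_image_sub_le_of_norm_fderiv_le
      (fun z _ => hac.differentiable (by simp) z) (fun z _ => hKa z) (mem_univ q) (mem_univ p)
  have hb : ∀ p q, ‖b p - b q‖ ≤ K * ‖p - q‖ := fun p q =>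
    convex_univ.norm_image_sub_le_of_norm_fderiv_le
      (fun z _ => hbc.differentiable (by simp) z) (fun z _ => hKb z) (mem_univ q) (mem_univ p)
  obtain ⟨U, hU0, hU⟩ := core ⟨a, hac.continuous⟩ ⟨b, hbc.continuous⟩ M K hK hac hbc ha hb hb0
  simp only [ContinuousMap.coe_mk] at hU
  have hτ : ∀ t : ℝ, |t| ≤ 1 / (4 * K) → |t| * K < 1 / 2 := by
    intro t ht
    have : |t| * K ≤ 1 / (4 * K) * K := by gcongr
    have e : 1 / (4 * K) * K = 1 / 4 := by field_simp
    rw [e] at this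
    linarith
  refine ⟨fun x t => U (x, t), ⟨2 * |M|, fun x t ht => (hU x t (hτ t ht)).2.1⟩, ?_, hU0, ?_⟩
  · intro q hq
    exact (hU q.1 q.2 (hτ q.2 (abs_le.2 hq.2))).1.contDiffWithinAt
  · intro x t ht
    obtain ⟨h1, -, h3⟩ := hU x t (hτ t ht)
    have dU : HasFDerivAt U (fderiv ℝ U (x, t)) (x, t) :=
      (h1.differentiableAt (by simp)).hasFDerivAt
    have d1 : HasDerivAt (fun s : ℝ => U (x, s)) (fderiv ℝ U (x, t) (0, 1)) t :=
      dU.comp_hasDerivAt t ((hasDerivAt_const _ _).prodMk (hasDerivAt_id _))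
    have d2 := (HasFDerivAt.comp (f := fun y => (y, t)) x dU
      (hasFDerivAt_prodMk_left (𝕜 := ℝ) x t)).fderiv
    have d3 : fderiv ℝ (fun y : Fin N → ℝ => U (y, t)) x =
      fderiv ℝ U (x, t) ∘L .inl ℝ (Fin N → ℝ) ℝ := d2
    simp only
    rw [d1.deriv, d3]
    set T := fderiv ℝ U (x, t) ∘L .inl ℝ (Fin N → ℝ) ℝ with hT
    have s1 : ∑ i : Fin N, a (x, U (x, t)) i * T (Pi.single i 1) = T (a (x, U (x, t))) := by
      conv_rhs => rw [pi_eq_sum_univ' (a (x, U (x, t)))]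
      rw [map_sum]
      refine Finset.sum_congr rfl fun i _ => ?_
      rw [map_smul, smul_eq_mul]
    rw [s1]
    have s2 : fderiv ℝ U (x, t) (a (x, U (x, t)), 1) =
        T (a (x, U (x, t))) + fderiv ℝ U (x, t) (0, 1) := by
      rw [hT, ContinuousLinearMap.comp_apply, ← map_add]
      congr 1
      simp
    rw [s2] at h3
    linarith
end

section
/- Let T > 0 and W ∈ C¹([0,T]). Let χ ∈ L^∞(ℝ^N × ℝ × (0,T)) with ‖χ‖_∞ ≤ 1, and let m be a finite nonnegative Borel measure on ℝ^N × ℝ × (0,T), such that for every φ ∈ C_c^∞(ℝ^N × ℝ × (0,T)): ∫_0^T ∫_ℝ ∫_{ℝ^N} χ(x,ξ,t) [ ∂_t φ(x,ξ,t) + Ẇ(t)( a(x,ξ)·D_x φ(x,ξ,t) − b(x,ξ) ∂_ξ φ(x,ξ,t) ) ] dx dξ dt = ∫ ∂_ξ φ dm. Let ρ : ℝ^N × ℝ × [0,T] → ℝ be C¹, suppose there is a compact set of ℝ^N × ℝ containing the support of ρ(·,·,t) for every t ∈ [0,T], and suppose ρ solves ∂_t ρ + Ẇ(t)( a·D_x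 ρ − b ∂_ξ ρ ) = 0 on ℝ^N × ℝ × [0,T]. Then for almost every t₁, t₂ with 0 < t₁ < t₂ < T: ∫_{ℝ^N×ℝ} ρ(x,ξ,t₂) χ(x,ξ,t₂) dx dξ − ∫_{ℝ^N×ℝ} ρ(x,ξ,t₁) χ(x,ξ,t₁) dx dξ = − ∫_{ℝ^N × ℝ × (t₁,t₂)} ∂_ξ ρ dm. -/
open MeasureTheory

noncomputable def bmp (E : Type*) [NormedAddCommGroup E] (n : ℕ) : ContDiffBump (0 : E) where
  rIn := 1 / ((n : ℝ) + 1) / 2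
  rOut := 1 / ((n : ℝ) + 1)
  rIn_pos := by positivity
  rIn_lt_rOut := by
    have : (0 : ℝ) < 1 / ((n : ℝ) + 1) := by positivity
    linarith

lemma bmp_tendsto (E : Type*) [NormedAddCommGroup E] :
    Filter.Tendsto (fun n => (bmp E n).rOut) Filter.atTop (nhds 0) :=
  tendsto_one_div_add_atTop_nhds_zero_nat

lemma bmp_le_one (E : Type*) [NormedAddCommGroup E] (n : ℕ) : (bmp E n).rOut ≤ 1 := by
  show 1 / ((n : ℝ) + 1) ≤ 1
  rw [div_le_one (by positivity)]
  have : (0 : ℝ) ≤ n := by positivity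
  linarith

lemma conv_zero_of_disjoint {E F : Type*} [NormedAddCommGroup E] [NormedSpace ℝ E]
    [FiniteDimensional ℝ E] [MeasurableSpace E] [BorelSpace E] (μ : Measure E)
    [μ.IsAddHaarMeasure] [NormedAddCommGroup F] [NormedSpace ℝ F] [CompleteSpace F]
    (η : ContDiffBump (0 : E)) (g : E → F) (hg : Continuous g) (x : E)
    (hx : ∀ y ∈ Metric.ball x η.rOut, g y = 0) :
    convolution (η.normed μ) g (ContinuousLinearMap.lsmul ℝ ℝ) μ x = 0 := by
  have h0 := hx x (Metric.mem_ball_self η.rOut_pos)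
  have := η.dist_normed_convolution_le (μ := μ) (g := g) (x₀ := x) (ε := 0)
    hg.aestronglyMeasurable (by intro y hy; rw [hx y hy, h0, dist_self])
  rw [h0] at this
  exact dist_le_zero.1 this

lemma weak_ext {E : Type*} [NormedAddCommGroup E] [NormedSpace ℝ E]
    [FiniteDimensional ℝ E] [MeasurableSpace E] [BorelSpace E] (μ : Measure E)
    [μ.IsAddHaarMeasure] (m : Measure E) [IsFiniteMeasure m] (U : Set E) (hU : IsOpen U)
    (V : E → E) (hV : Continuous V) (e : E) (χ : E → ℝ) (hχm : Measurable χ)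
    (hχb : ∀ᵐ q ∂μ, |χ q| ≤ 1)
    (hw : ∀ φ : E → ℝ, ContDiff ℝ (⊤ : ℕ∞) φ → HasCompactSupport φ → (∀ q, q ∉ U → φ q = 0) →
      ∫ q, χ q * fderiv ℝ φ q (V q) ∂μ = ∫ q, fderiv ℝ φ q e ∂m)
    (φ : E → ℝ) (hφ : ContDiff ℝ 1 φ) (hc : HasCompactSupport φ) (hs : tsupport φ ⊆ U) :
    ∫ q, χ q * fderiv ℝ φ q (V q) ∂μ = ∫ q, fderiv ℝ φ q e ∂m := by
  have hDc : Continuous (fderiv ℝ φ) := hφ.continuous_fderiv one_ne_zero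
  have hDs : HasCompactSupport (fderiv ℝ φ) := hc.fderiv ℝ
  have hDz : ∀ y, y ∉ tsupport φ → fderiv ℝ φ y = 0 := fun y hy =>
    image_eq_zero_of_notMem_tsupport (fun h => hy (tsupport_fderiv_subset ℝ h))
  obtain ⟨C, hC⟩ := hDs.exists_bound_of_continuous hDc
  have hC0 : 0 ≤ C := (norm_nonneg _).trans (hC 0)
  set ψ : ℕ → E → ℝ := fun n =>
    convolution ((bmp E n).normed μ) φ (ContinuousLinearMap.lsmul ℝ ℝ) μ with hψ
  set D : ℕ → E → (E →L[ℝ] ℝ) := fun n =>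
    convolution ((bmp E n).normed μ) (fderiv ℝ φ) (ContinuousLinearMap.lsmul ℝ ℝ) μ with hD
  have hLoc : ∀ n, LocallyIntegrable ((bmp E n).normed μ) μ := fun n =>
    (bmp E n).continuous_normed.locallyIntegrable
  have hψs : ∀ n, ContDiff ℝ (⊤ : ℕ∞) (ψ n) := fun n =>
    (bmp E n).hasCompactSupport_normed.contDiff_convolution_left _
      ((bmp E n).contDiff_normed) hφ.continuous.locallyIntegrable
  have hψc : ∀ n, HasCompactSupport (ψ n) := fun n =>
    (bmp E n).hasCompactSupport_normed.convolution _ hc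
  have hprec : ((ContinuousLinearMap.lsmul ℝ ℝ : ℝ →L[ℝ] ℝ →L[ℝ] ℝ).precompR E)
      = (ContinuousLinearMap.lsmul ℝ ℝ : ℝ →L[ℝ] (E →L[ℝ] ℝ) →L[ℝ] (E →L[ℝ] ℝ)) := by
    ext; simp [ContinuousLinearMap.precompR]
  have hψD : ∀ n q, fderiv ℝ (ψ n) q = D n q := by
    intro n q
    have := (hc.hasFDerivAt_convolution_right (ContinuousLinearMap.lsmul ℝ ℝ) (hLoc n) hφ q).fderiv
    rw [hprec] at this
    exact this
  have hDcont : ∀ n, Continuous (D n) := by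
    intro n
    have : D n = fderiv ℝ (ψ n) := by ext1 q; rw [hψD]
    rw [this]
    exact (hψs n).continuous_fderiv (by simp)
  have hDt : ∀ q, Filter.Tendsto (fun n => D n q) Filter.atTop (nhds (fderiv ℝ φ q)) := fun q =>
    ContDiffBump.convolution_tendsto_right_of_continuous (bmp_tendsto E) hDc q
  have hDb : ∀ n q, ‖D n q‖ ≤ 3 * C := by
    intro n q
    have h := (bmp E n).dist_normed_convolution_le (μ := μ) (g := fderiv ℝ φ) (x₀ := q)
      (ε := 2 * C) hDc.aestronglyMeasurable (by
        intro y _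
        rw [dist_eq_norm]
        have := norm_sub_le (fderiv ℝ φ y) (fderiv ℝ φ q)
        linarith [hC y, hC q])
    rw [dist_eq_norm] at h
    have h2 := norm_add_le (D n q - fderiv ℝ φ q) (fderiv ℝ φ q)
    rw [sub_add_cancel] at h2
    have h3 : ‖D n q - fderiv ℝ φ q‖ ≤ 2 * C := h
    linarith [hC q]
  set K := Metric.cthickening 1 (tsupport φ) with hK
  have hKc : IsCompact K := hc.isCompact.cthickening
  have hball : ∀ n q δ, (bmp E n).rOut ≤ δ → q ∉ Metric.thickening δ (tsupport φ) →
      ∀ y ∈ Metric.ball q (bmp E n).rOut, y ∉ tsupport φ := by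
    intro n q δ hδ hq y hy hy'
    apply hq
    rw [Metric.mem_thickening_iff]
    rw [Metric.mem_ball, dist_comm] at hy
    exact ⟨y, hy', hy.trans_le hδ⟩
  have hDK : ∀ n q, q ∉ K → D n q = 0 := by
    intro n q hq
    apply conv_zero_of_disjoint _ _ _ hDc
    intro y hy
    exact hDz y (hball n q 1 (bmp_le_one E n)
      (fun h => hq (Metric.thickening_subset_cthickening _ _ h)) y hy)
  obtain ⟨δ, hδ, hδU⟩ := hc.isCompact.exists_thickening_subset_open hU hs
  have hev : ∀ᶠ n in Filter.atTop, ∫ q, χ q * D n q (V q) ∂μ = ∫ q, D n q e ∂m := by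
    filter_upwards [(bmp_tendsto E).eventually_le_const hδ] with n hn
    have := hw (ψ n) (hψs n) (hψc n) (by
      intro q hq
      apply conv_zero_of_disjoint _ _ _ hφ.continuous
      intro y hy
      exact image_eq_zero_of_notMem_tsupport (hball n q δ hn (fun h => hq (hδU h)) y hy))
    simpa only [hψD] using this
  obtain ⟨M, hM⟩ := hKc.exists_bound_of_continuousOn hV.continuousOn
  have hL : Filter.Tendsto (fun n => ∫ q, χ q * D n q (V q) ∂μ) Filter.atTop
      (nhds (∫ q, χ q * fderiv ℝ φ q (V q) ∂μ)) := by
    apply tendsto_integral_of_dominated_convergence (K.indicator fun _ => 3 * C * M)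
    · intro n
      exact hχm.aestronglyMeasurable.mul ((hDcont n).clm_apply hV).aestronglyMeasurable
    · rw [integrable_indicator_iff hKc.measurableSet]
      exact integrableOn_const hKc.measure_lt_top.ne
    · intro n
      filter_upwards [hχb] with q hq
      by_cases hqK : q ∈ K
      · rw [Set.indicator_of_mem hqK, norm_mul, Real.norm_eq_abs (χ q)]
        have h1 : ‖D n q (V q)‖ ≤ 3 * C * M :=
          ((D n q).le_opNorm _).trans
            (mul_le_mul (hDb n q) (hM q hqK) (norm_nonneg _) (by positivity))
        calc |χ q| * ‖D n q (V q)‖ ≤ 1 * ‖D n q (V q)‖ := by gcongr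
          _ ≤ _ := by rw [one_mul]; exact h1
      · rw [hDK n q hqK, Set.indicator_of_notMem hqK]; simp
    · refine Filter.Eventually.of_forall fun q => ?_
      exact (((ContinuousLinearMap.apply ℝ ℝ (V q)).continuous.tendsto _).comp (hDt q)).const_mul _
  have hR : Filter.Tendsto (fun n => ∫ q, D n q e ∂m) Filter.atTop
      (nhds (∫ q, fderiv ℝ φ q e ∂m)) := by
    apply tendsto_integral_of_dominated_convergence (fun _ => 3 * C * ‖e‖)
    · intro n
      exact ((hDcont n).clm_apply continuous_const).aestronglyMeasurable
    · exact integrable_const _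
    · intro n
      refine Filter.Eventually.of_forall fun q => ?_
      exact ((D n q).le_opNorm _).trans (mul_le_mul_of_nonneg_right (hDb n q) (norm_nonneg _))
    · refine Filter.Eventually.of_forall fun q => ?_
      exact ((ContinuousLinearMap.apply ℝ ℝ e).continuous.tendsto _).comp (hDt q)
  exact tendsto_nhds_unique_of_eventuallyEq hL hR hev

/-- smoothed Heaviside function -/
noncomputable def Hv (n : ℕ) (u : ℝ) : ℝ :=
  ∫ x in (-(bmp ℝ n).rOut)..u, (bmp ℝ n).normed volume x

lemma Hv_deriv (n : ℕ) (u : ℝ) : HasDerivAt (Hv n) ((bmp ℝ n).normed volume u) u :=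
  intervalIntegral.integral_hasDerivAt_right
    ((bmp ℝ n).continuous_normed.intervalIntegrable _ _)
    ((bmp ℝ n).continuous_normed.stronglyMeasurableAtFilter _ _)
    (bmp ℝ n).continuous_normed.continuousAt

lemma Hv_contDiff (n : ℕ) : ContDiff ℝ 1 (Hv n) := by
  rw [contDiff_one_iff_deriv]
  refine ⟨fun u => (Hv_deriv n u).differentiableAt, ?_⟩
  have : deriv (Hv n) = (bmp ℝ n).normed volume := by ext u; exact (Hv_deriv n u).deriv
  rw [this]
  exact (bmp ℝ n).continuous_normed

lemma Hv_mono (n : ℕ) : Monotone (Hv n) :=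
  monotone_of_hasDerivAt_nonneg (Hv_deriv n) fun u => (bmp ℝ n).nonneg_normed u

lemma bmp_zero (n : ℕ) (u : ℝ) (hu : (bmp ℝ n).rOut ≤ |u|) : (bmp ℝ n).normed volume u = 0 := by
  by_contra h
  have : u ∈ Function.support ((bmp ℝ n).normed volume) := h
  rw [ContDiffBump.support_normed_eq, mem_ball_zero_iff, Real.norm_eq_abs] at this
  linarith

lemma Hv_left (n : ℕ) (u : ℝ) (hu : u ≤ -(bmp ℝ n).rOut) : Hv n u = 0 := by
  unfold Hv
  apply intervalIntegral.integral_zero_ae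
  refine Filter.Eventually.of_forall fun x hx => ?_
  rw [Set.uIoc_of_ge hu] at hx
  apply bmp_zero
  have := (bmp ℝ n).rOut_pos
  rw [abs_of_nonpos (by linarith [hx.2])]
  linarith [hx.2]

lemma Hv_right (n : ℕ) (u : ℝ) (hu : (bmp ℝ n).rOut ≤ u) : Hv n u = 1 := by
  unfold Hv
  rw [intervalIntegral.integral_eq_integral_of_support_subset, ContDiffBump.integral_normed]
  rw [ContDiffBump.support_normed_eq, Real.ball_eq_Ioo]
  intro x hx
  exact ⟨by linarith [hx.1], by linarith [hx.2]⟩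

lemma Hv_bound (n : ℕ) (u : ℝ) : 0 ≤ Hv n u ∧ Hv n u ≤ 1 := by
  constructor
  · rcases le_total u (-(bmp ℝ n).rOut) with h | h
    · rw [Hv_left n u h]
    · rw [← Hv_left n _ le_rfl]; exact Hv_mono n h
  · rcases le_total u ((bmp ℝ n).rOut) with h | h
    · rw [← Hv_right n _ le_rfl]; exact Hv_mono n h
    · rw [Hv_right n u h]

/-- smoothed indicator of an interval -/
noncomputable def Th (t₁ t₂ : ℝ) (n : ℕ) (t : ℝ) : ℝ := Hv n (t - t₁) - Hv n (t - t₂)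

lemma Th_deriv (t₁ t₂ : ℝ) (n : ℕ) (t : ℝ) : HasDerivAt (Th t₁ t₂ n)
    ((bmp ℝ n).normed volume (t - t₁) - (bmp ℝ n).normed volume (t - t₂)) t :=
  ((Hv_deriv n (t - t₁)).comp_sub_const t t₁).sub ((Hv_deriv n (t - t₂)).comp_sub_const t t₂)

lemma Th_contDiff (t₁ t₂ : ℝ) (n : ℕ) : ContDiff ℝ 1 (Th t₁ t₂ n) :=
  ((Hv_contDiff n).comp (contDiff_id.sub contDiff_const)).sub
    ((Hv_contDiff n).comp (contDiff_id.sub contDiff_const))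

lemma Th_bound (t₁ t₂ : ℝ) (n : ℕ) (t : ℝ) : |Th t₁ t₂ n t| ≤ 1 := by
  unfold Th
  have h1 := Hv_bound n (t - t₁)
  have h2 := Hv_bound n (t - t₂)
  rw [abs_le]
  constructor <;> linarith [h1.1, h1.2, h2.1, h2.2]

lemma Th_zero (t₁ t₂ : ℝ) (h12 : t₁ < t₂) (n : ℕ) (t : ℝ)
    (ht : t ∉ Set.Icc (t₁ - (bmp ℝ n).rOut) (t₂ + (bmp ℝ n).rOut)) : Th t₁ t₂ n t = 0 := by
  unfold Th
  rw [Set.mem_Icc, not_and_or, not_le, not_le] at ht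
  rcases ht with h | h
  · rw [Hv_left n _ (by linarith), Hv_left n _ (by linarith), sub_zero]
  · rw [Hv_right n _ (by linarith), Hv_right n _ (by linarith), sub_self]

lemma Th_tendsto (t₁ t₂ : ℝ) (h12 : t₁ < t₂) (t : ℝ) (h1 : t ≠ t₁) (h2 : t ≠ t₂) :
    Filter.Tendsto (fun n => Th t₁ t₂ n t) Filter.atTop
      (nhds ((Set.Ioo t₁ t₂).indicator (fun _ => 1) t)) := by
  apply tendsto_const_nhds.congr'
  have e1 := (bmp_tendsto ℝ).eventually_le_const (abs_pos.2 (sub_ne_zero.2 h1))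
  have e2 := (bmp_tendsto ℝ).eventually_le_const (abs_pos.2 (sub_ne_zero.2 h2))
  filter_upwards [e1, e2] with n k1 k2
  unfold Th
  rcases lt_or_gt_of_ne h1 with c1 | c1
  · rw [abs_of_neg (by linarith)] at k1 k2
    rw [Hv_left n _ (by linarith), Hv_left n _ (by linarith),
      Set.indicator_of_notMem (fun h => by linarith [h.1]), sub_zero]
  · rw [abs_of_pos (by linarith)] at k1
    rcases lt_or_gt_of_ne h2 with c2 | c2
    · rw [abs_of_neg (by linarith)] at k2
      rw [Hv_right n _ (by linarith), Hv_left n _ (by linarith),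
        Set.indicator_of_mem (show t ∈ Set.Ioo t₁ t₂ from ⟨c1, c2⟩), sub_zero]
    · rw [abs_of_pos (by linarith)] at k2
      rw [Hv_right n _ (by linarith), Hv_right n _ (by linarith),
        Set.indicator_of_notMem (fun h => by linarith [h.2]), sub_self]

lemma conv_t {N : ℕ} (φ : (((Fin N → ℝ) × ℝ) × ℝ) → ℝ) (q : ((Fin N → ℝ) × ℝ) × ℝ)
    (h : DifferentiableAt ℝ φ q) :
    deriv (fun s : ℝ => φ (q.1, s)) q.2 = fderiv ℝ φ q (0, 1) := by
  have h1 : HasDerivAt (fun s : ℝ => ((q.1, s) : ((Fin N → ℝ) × ℝ) × ℝ)) (0, 1) q.2 :=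
    (hasDerivAt_const _ _).prodMk (hasDerivAt_id _)
  exact (h.hasFDerivAt.comp_hasDerivAt q.2 h1).deriv

lemma conv_p {N : ℕ} (φ : (((Fin N → ℝ) × ℝ) × ℝ) → ℝ) (q : ((Fin N → ℝ) × ℝ) × ℝ)
    (h : DifferentiableAt ℝ φ q) (v : (Fin N → ℝ) × ℝ) :
    fderiv ℝ (fun p : (Fin N → ℝ) × ℝ => φ (p, q.2)) q.1 v = fderiv ℝ φ q (v, 0) := by
  have h1 : HasFDerivAt (fun p : (Fin N → ℝ) × ℝ => ((p, q.2) : ((Fin N → ℝ) × ℝ) × ℝ))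
      ((ContinuousLinearMap.id ℝ _).prod 0) q.1 :=
    (hasFDerivAt_id _).prodMk (hasFDerivAt_const _ _)
  have := (HasFDerivAt.comp (g := φ) q.1 h.hasFDerivAt h1).fderiv
  have h2 : fderiv ℝ (fun p : (Fin N → ℝ) × ℝ => φ (p, q.2)) q.1 = _ := this
  rw [h2]; simp

lemma conv_xi {N : ℕ} (φ : (((Fin N → ℝ) × ℝ) × ℝ) → ℝ) (q : ((Fin N → ℝ) × ℝ) × ℝ)
    (h : DifferentiableAt ℝ φ q) :
    deriv (fun ξ : ℝ => φ ((q.1.1, ξ), q.2)) q.1.2 = fderiv ℝ φ q ((0, 1), 0) := by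
  have h1 : HasDerivAt (fun s : ℝ => (((q.1.1, s), q.2) : ((Fin N → ℝ) × ℝ) × ℝ))
      ((0, 1), 0) q.1.2 :=
    ((hasDerivAt_const _ _).prodMk (hasDerivAt_id _)).prodMk (hasDerivAt_const _ _)
  exact (h.hasFDerivAt.comp_hasDerivAt q.1.2 h1).deriv

/-- the characteristic vector field -/
noncomputable def Vf {N : ℕ} (a : (Fin N → ℝ) × ℝ → (Fin N → ℝ)) (b : (Fin N → ℝ) × ℝ → ℝ)
    (W : ℝ → ℝ) (q : ((Fin N → ℝ) × ℝ) × ℝ) : ((Fin N → ℝ) × ℝ) × ℝ :=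
  (deriv W q.2 • (a q.1, - b q.1), 1)

lemma conv_all {N : ℕ} (a : (Fin N → ℝ) × ℝ → (Fin N → ℝ)) (b : (Fin N → ℝ) × ℝ → ℝ)
    (W : ℝ → ℝ) (φ : (((Fin N → ℝ) × ℝ) × ℝ) → ℝ) (q : ((Fin N → ℝ) × ℝ) × ℝ)
    (h : DifferentiableAt ℝ φ q) :
    deriv (fun s : ℝ => φ (q.1, s)) q.2
            + deriv W q.2 *
              ((∑ i : Fin N, a q.1 i *
                  fderiv ℝ (fun p : (Fin N → ℝ) × ℝ => φ (p, q.2)) q.1 (Pi.single i 1, 0))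
                - b q.1 *
                  fderiv ℝ (fun p : (Fin N → ℝ) × ℝ => φ (p, q.2)) q.1 (0, 1))
      = fderiv ℝ φ q (Vf a b W q) := by
  rw [conv_t φ q h]
  simp only [conv_p φ q h]
  set L := fderiv ℝ φ q
  have hv : Vf a b W q = (0, 1) + deriv W q.2 • ((∑ i : Fin N, a q.1 i •
      (((Pi.single i 1, 0), 0) : ((Fin N → ℝ) × ℝ) × ℝ)) - b q.1 • ((0, 1), 0)) := by
    unfold Vf
    ext j
    · simp [Prod.fst_sum, Finset.sum_apply, Pi.single_apply]
    · simp [Prod.fst_sum, Prod.snd_sum]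
    · simp [Prod.snd_sum]
  rw [hv]
  simp only [map_add, map_smul, map_sub, map_sum, smul_eq_mul]

lemma Vf_cont {N : ℕ} (a : (Fin N → ℝ) × ℝ → (Fin N → ℝ)) (b : (Fin N → ℝ) × ℝ → ℝ)
    (W : ℝ → ℝ) (ha : Continuous a) (hb : Continuous b) (hW : ContDiff ℝ 1 W) :
    Continuous (Vf a b W) := by
  have h := (hW.continuous_deriv (le_refl _))
  unfold Vf
  fun_prop

lemma fderiv_mul_time {N : ℕ} (ρ : (((Fin N → ℝ) × ℝ) × ℝ) → ℝ) (θ : ℝ → ℝ) (θ' : ℝ)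
    (q v : ((Fin N → ℝ) × ℝ) × ℝ) (h : DifferentiableAt ℝ ρ q) (hθ : HasDerivAt θ θ' q.2) :
    fderiv ℝ (fun q => ρ q * θ q.2) q v = ρ q * θ' * v.2 + θ q.2 * fderiv ℝ ρ q v := by
  have h1 : HasFDerivAt (fun q : ((Fin N → ℝ) × ℝ) × ℝ => θ q.2) _ q :=
    hθ.hasFDerivAt.comp q hasFDerivAt_snd
  have h2 : HasFDerivAt (fun q => ρ q * θ q.2) _ q := h.hasFDerivAt.mul h1
  rw [h2.fderiv]
  simp
  ring

/-- duality formula, equations (21)-(22) of the paper: Let `W ∈ C¹`,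
let `χ ∈ L^∞(ℝ^N × ℝ × (0,T))` with `‖χ‖_∞ ≤ 1` and let `m` be a finite nonnegative
Borel measure supported in time in `(0,T)` such that for every
`φ ∈ C_c^∞(ℝ^N × ℝ × (0,T))`:
`∫ χ (∂_t φ + Ẇ (a·D_x φ - b ∂_ξ φ)) = ∫ ∂_ξ φ dm`.
If `ρ` is `C¹`, compactly supported in `(x,ξ)` uniformly for `t ∈ [0,T]`, and solves
`∂_t ρ + Ẇ (a·D_x ρ - b ∂_ξ ρ) = 0` on `ℝ^N × ℝ × [0,T]`, then for almost every
`0 < t₁ < t₂ < T`,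
`∫ ρ(·,t₂) χ(·,t₂) - ∫ ρ(·,t₁) χ(·,t₁) = -∫_{t ∈ (t₁,t₂)} ∂_ξ ρ dm`. -/
theorem stmt15 (N : ℕ) (hN : 1 ≤ N) (T : ℝ) (hT : 0 < T)
    (a : (Fin N → ℝ) × ℝ → (Fin N → ℝ)) (b : (Fin N → ℝ) × ℝ → ℝ)
    (ha : Continuous a) (hb : Continuous b)
    (habLip : ∃ K : NNReal, LipschitzWith K a ∧ LipschitzWith K b)
    (W : ℝ → ℝ) (hW : ContDiff ℝ 1 W)
    (χ : (((Fin N → ℝ) × ℝ) × ℝ) → ℝ) (hχm : Measurable χ)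
    (hχb : ∀ᵐ q : ((Fin N → ℝ) × ℝ) × ℝ, |χ q| ≤ 1)
    (m : Measure ((((Fin N → ℝ) × ℝ) × ℝ))) (hmfin : IsFiniteMeasure m)
    (hmsupp : m {q : ((Fin N → ℝ) × ℝ) × ℝ | q.2 ∉ Set.Ioo 0 T} = 0)
    (hweak : ∀ φ : (((Fin N → ℝ) × ℝ) × ℝ) → ℝ, ContDiff ℝ (⊤ : ℕ∞) φ →
      HasCompactSupport φ →
      (∀ (p : (Fin N → ℝ) × ℝ) (t : ℝ), t ∉ Set.Ioo 0 T → φ (p, t) = 0) →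
      ∫ q : ((Fin N → ℝ) × ℝ) × ℝ,
          χ q * (deriv (fun s : ℝ => φ (q.1, s)) q.2
            + deriv W q.2 *
              ((∑ i : Fin N, a q.1 i *
                  fderiv ℝ (fun p : (Fin N → ℝ) × ℝ => φ (p, q.2)) q.1 (Pi.single i 1, 0))
                - b q.1 *
                  fderiv ℝ (fun p : (Fin N → ℝ) × ℝ => φ (p, q.2)) q.1 (0, 1)))
        = ∫ q : ((Fin N → ℝ) × ℝ) × ℝ,
            deriv (fun ξ : ℝ => φ ((q.1.1, ξ), q.2)) q.1.2 ∂m)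
    (ρ : (((Fin N → ℝ) × ℝ) × ℝ) → ℝ) (hρ : ContDiff ℝ 1 ρ)
    (hρsupp : ∃ Kc : Set ((Fin N → ℝ) × ℝ), IsCompact Kc ∧
      ∀ t ∈ Set.Icc (0 : ℝ) T, ∀ p : (Fin N → ℝ) × ℝ, p ∉ Kc → ρ (p, t) = 0)
    (hρPDE : ∀ (p : (Fin N → ℝ) × ℝ), ∀ t ∈ Set.Icc (0 : ℝ) T,
      deriv (fun s : ℝ => ρ (p, s)) t
        + deriv W t *
          ((∑ i : Fin N, a p i *
              fderiv ℝ (fun p' : (Fin N → ℝ) × ℝ => ρ (p', t)) p (Pi.single i 1, 0))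
            - b p * fderiv ℝ (fun p' : (Fin N → ℝ) × ℝ => ρ (p', t)) p (0, 1)) = 0) :
    ∃ S : Set ℝ, S ⊆ Set.Ioo 0 T ∧ volume (Set.Ioo 0 T \ S) = 0 ∧
      ∀ t₁ ∈ S, ∀ t₂ ∈ S, t₁ < t₂ →
        (∫ p : (Fin N → ℝ) × ℝ, ρ (p, t₂) * χ (p, t₂))
          - (∫ p : (Fin N → ℝ) × ℝ, ρ (p, t₁) * χ (p, t₁))
        = - ∫ q in {q : ((Fin N → ℝ) × ℝ) × ℝ | q.2 ∈ Set.Ioo t₁ t₂},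
              deriv (fun ξ : ℝ => ρ ((q.1.1, ξ), q.2)) q.1.2 ∂m := by
  obtain ⟨Kc, hKc, hρ0⟩ := hρsupp
  have hρd : ∀ q, DifferentiableAt ℝ ρ q := fun q => hρ.differentiable one_ne_zero q
  have hρc := hρ.continuous
  have hh1 : (volume : Measure ((Fin N → ℝ) × ℝ)).IsAddHaarMeasure :=
    inferInstanceAs ((volume : Measure (Fin N → ℝ)).prod (volume : Measure ℝ)).IsAddHaarMeasure
  have hh2 : (volume : Measure (((Fin N → ℝ) × ℝ) × ℝ)).IsAddHaarMeasure :=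
    inferInstanceAs
      ((volume : Measure ((Fin N → ℝ) × ℝ)).prod (volume : Measure ℝ)).IsAddHaarMeasure
  set e : ((Fin N → ℝ) × ℝ) × ℝ := ((0, 1), 0) with he
  have hU : IsOpen {q : (((Fin N → ℝ) × ℝ) × ℝ) | q.2 ∈ Set.Ioo 0 T} := isOpen_Ioo.preimage continuous_snd
  -- weak form for C¹ test functions
  have key := fun φ h1 h2 h3 => weak_ext (E := ((Fin N → ℝ) × ℝ) × ℝ) volume m {q : (((Fin N → ℝ) × ℝ) × ℝ) | q.2 ∈ Set.Ioo 0 T} hU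
    (Vf a b W) (Vf_cont a b W ha hb hW) e χ hχm hχb (by
      intro φ h1 h2 h3
      have hd : ∀ q, DifferentiableAt ℝ φ q := fun q => h1.differentiable (by simp) q
      have := hweak φ h1 h2 (fun p t ht => h3 (p, t) ht)
      simp only [fun q => conv_all a b W φ q (hd q), fun q => conv_xi φ q (hd q)] at this
      exact this) φ h1 h2 h3
  simp only [fun q => conv_xi ρ q (hρd q)]
  -- PDE
  have hpde : ∀ q : (((Fin N → ℝ) × ℝ) × ℝ), q.2 ∈ Set.Icc 0 T → fderiv ℝ ρ q (Vf a b W q) = 0 := by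
    intro q hq
    rw [← conv_all a b W ρ q (hρd q)]
    exact hρPDE q.1 q.2 hq
  -- bound on the derivative
  have hDc : Continuous (fun q => fderiv ℝ ρ q e) :=
    (hρ.continuous_fderiv one_ne_zero).clm_apply continuous_const
  have hKT : IsCompact (Kc ×ˢ Set.Icc 0 T : Set (((Fin N → ℝ) × ℝ) × ℝ)) := hKc.prod isCompact_Icc
  obtain ⟨M, hM⟩ := hKT.exists_bound_of_continuousOn hDc.continuousOn
  obtain ⟨R, hR⟩ := hKT.exists_bound_of_continuousOn hρc.continuousOn
  have hDz : ∀ q : (((Fin N → ℝ) × ℝ) × ℝ), q.2 ∈ Set.Icc 0 T → q.1 ∉ Kc → fderiv ℝ ρ q e = 0 := by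
    intro q hq hqK
    rw [he, ← conv_p ρ q (hρd q)]
    have : (fun p : (Fin N → ℝ) × ℝ => ρ (p, q.2)) =ᶠ[nhds q.1] fun _ => 0 := by
      filter_upwards [hKc.isClosed.isOpen_compl.mem_nhds hqK] with p hp
      exact hρ0 q.2 hq p hp
    rw [this.fderiv_eq]
    simp
  have hDb : ∀ q : (((Fin N → ℝ) × ℝ) × ℝ), q.2 ∈ Set.Icc 0 T → ‖fderiv ℝ ρ q e‖ ≤ |M| := by
    intro q hq
    by_cases hqK : q.1 ∈ Kc
    · exact (hM q ⟨hqK, hq⟩).trans (le_abs_self _)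
    · rw [hDz q hq hqK, norm_zero]; exact abs_nonneg _
  -- the function G
  set A : Set (((Fin N → ℝ) × ℝ) × ℝ) := Kc ×ˢ Set.Ioo 0 T with hA
  have hAm : MeasurableSet A := hKc.measurableSet.prod measurableSet_Ioo
  set G : (((Fin N → ℝ) × ℝ) × ℝ) → ℝ := A.indicator (fun q => ρ q * χ q) with hG
  have hGi : Integrable G (volume : Measure (((Fin N → ℝ) × ℝ) × ℝ)) := by
    rw [hG, integrable_indicator_iff hAm]
    refine Measure.integrableOn_of_bounded (M := |R|) ?_ ?_ ?_
    · exact ((measure_mono (Set.prod_mono_right Set.Ioo_subset_Icc_self)).trans_lt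
        hKT.measure_lt_top).ne
    · exact hρc.aestronglyMeasurable.mul hχm.aestronglyMeasurable
    · filter_upwards [ae_restrict_of_ae hχb, ae_restrict_mem hAm] with q hq hqA
      rw [norm_mul, Real.norm_eq_abs (χ q)]
      calc ‖ρ q‖ * |χ q| ≤ |R| * 1 := by
            gcongr
            exact (hR q ⟨hqA.1, Set.Ioo_subset_Icc_self hqA.2⟩).trans (le_abs_self _)
        _ = |R| := mul_one _
  have hGeq : ∀ p t, t ∈ Set.Ioo 0 T → G (p, t) = ρ (p, t) * χ (p, t) := by
    intro p t ht
    by_cases hp : p ∈ Kc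
    · rw [hG, Set.indicator_of_mem (show (p, t) ∈ A from ⟨hp, ht⟩)]
    · rw [hG, Set.indicator_of_notMem (fun h : (p, t) ∈ A => hp h.1),
        hρ0 t (Set.Ioo_subset_Icc_self ht) p hp, zero_mul]
  set F : ℝ → ℝ := fun t => ∫ p, G (p, t) with hF
  have hFi : Integrable F volume := by
    have : Integrable G ((volume : Measure ((Fin N → ℝ) × ℝ)).prod (volume : Measure ℝ)) := hGi
    exact this.integral_prod_right
  have hFeq : ∀ t ∈ Set.Ioo 0 T, F t = ∫ p, ρ (p, t) * χ (p, t) := by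
    intro t ht
    simp only [hF, hGeq _ t ht]
  have hleb : ∀ᵐ t : ℝ, Filter.Tendsto (fun n => convolution ((bmp ℝ n).normed volume) F
      (ContinuousLinearMap.lsmul ℝ ℝ) volume t) Filter.atTop (nhds (F t)) :=
    ContDiffBump.ae_convolution_tendsto_right_of_locallyIntegrable (K := 2) (bmp_tendsto ℝ)
      (Filter.Eventually.of_forall fun n => by
        show 1 / ((n : ℝ) + 1) ≤ 2 * (1 / ((n : ℝ) + 1) / 2)
        linarith) hFi.locallyIntegrable
  have hcount : ∀ᵐ t : ℝ, m {q : (((Fin N → ℝ) × ℝ) × ℝ) | q.2 = t} = 0 := by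
    have := (Measure.countable_meas_level_set_pos (μ := m) (g := fun q : (((Fin N → ℝ) × ℝ) × ℝ) => q.2)
      measurable_snd).ae_notMem volume
    filter_upwards [this] with t ht
    simpa using ht
  refine ⟨{t | t ∈ Set.Ioo 0 T ∧ (Filter.Tendsto (fun n => convolution ((bmp ℝ n).normed volume) F
      (ContinuousLinearMap.lsmul ℝ ℝ) volume t) Filter.atTop (nhds (F t))) ∧
      m {q : (((Fin N → ℝ) × ℝ) × ℝ) | q.2 = t} = 0}, fun t ht => ht.1, ?_, ?_⟩
  · have h := hleb.and hcount
    rw [ae_iff] at h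
    refine measure_mono_null ?_ h
    rintro t ⟨ht, hn⟩ h'
    exact hn ⟨ht, h'⟩
  rintro t₁ ⟨ht1, hl1, hm1⟩ t₂ ⟨ht2, hl2, hm2⟩ h12
  rw [← hFeq t₁ ht1, ← hFeq t₂ ht2]
  -- identity for each large n
  have hid : ∀ᶠ n in Filter.atTop,
      convolution ((bmp ℝ n).normed volume) F (ContinuousLinearMap.lsmul ℝ ℝ) volume t₁
      - convolution ((bmp ℝ n).normed volume) F (ContinuousLinearMap.lsmul ℝ ℝ) volume t₂
      = ∫ q : (((Fin N → ℝ) × ℝ) × ℝ), Th t₁ t₂ n q.2 * fderiv ℝ ρ q e ∂m := by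
    filter_upwards [(bmp_tendsto ℝ).eventually_lt_const ht1.1,
      (bmp_tendsto ℝ).eventually_lt_const (sub_pos.2 ht2.2)] with n hn1 hn2
    set θ := Th t₁ t₂ n with hθ
    set η := (bmp ℝ n).normed volume with hη
    have hsub : Set.Icc (t₁ - (bmp ℝ n).rOut) (t₂ + (bmp ℝ n).rOut) ⊆ Set.Ioo 0 T := by
      intro t ht
      exact ⟨by linarith [ht.1], by linarith [ht.2]⟩
    set φ : (((Fin N → ℝ) × ℝ) × ℝ) → ℝ := fun q => ρ q * θ q.2 with hφ
    have hC : IsCompact (Kc ×ˢ Set.Icc (t₁ - (bmp ℝ n).rOut) (t₂ + (bmp ℝ n).rOut) : Set (((Fin N → ℝ) × ℝ) × ℝ)) :=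
      hKc.prod isCompact_Icc
    have hφ0 : ∀ q : (((Fin N → ℝ) × ℝ) × ℝ), q ∉ (Kc ×ˢ Set.Icc (t₁ - (bmp ℝ n).rOut) (t₂ + (bmp ℝ n).rOut) : Set (((Fin N → ℝ) × ℝ) × ℝ)) →
        φ q = 0 := by
      intro q hq
      by_cases hq2 : q.2 ∈ Set.Icc (t₁ - (bmp ℝ n).rOut) (t₂ + (bmp ℝ n).rOut)
      · have hq1 : q.1 ∉ Kc := fun h => hq ⟨h, hq2⟩
        have := hρ0 q.2 (Set.Ioo_subset_Icc_self (hsub hq2)) q.1 hq1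
        show ρ (q.1, q.2) * θ q.2 = 0
        rw [this, zero_mul]
      · show ρ q * θ q.2 = 0
        rw [hθ, Th_zero t₁ t₂ h12 n q.2 hq2, mul_zero]
    have hts : tsupport φ ⊆ {q : (((Fin N → ℝ) × ℝ) × ℝ) | q.2 ∈ Set.Ioo 0 T} := by
      have : tsupport φ ⊆ (Kc ×ˢ Set.Icc (t₁ - (bmp ℝ n).rOut) (t₂ + (bmp ℝ n).rOut) : Set (((Fin N → ℝ) × ℝ) × ℝ)) := by
        apply closure_minimal _ hC.isClosed
        intro q hq
        by_contra h
        exact hq (hφ0 q h)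
      exact fun q hq => hsub (this hq).2
    have hk := key φ (hρ.mul ((Th_contDiff t₁ t₂ n).comp contDiff_snd))
      (HasCompactSupport.intro hC hφ0) hts
    have hfd := fun q v => fderiv_mul_time ρ θ _ q v (hρd q) (Th_deriv t₁ t₂ n q.2)
    have hr : ∀ q : (((Fin N → ℝ) × ℝ) × ℝ), fderiv ℝ φ q e = θ q.2 * fderiv ℝ ρ q e := by
      intro q
      rw [hφ, hfd q e, he]; simp
    have hl : ∀ q : (((Fin N → ℝ) × ℝ) × ℝ), χ q * fderiv ℝ φ q (Vf a b W q)
        = G q * (η (t₁ - q.2) - η (t₂ - q.2)) := by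
      intro q
      rw [hφ, hfd q]
      have hs : ∀ s, η (s - q.2) = η (q.2 - s) := by
        intro s
        rw [hη, ← ContDiffBump.normed_neg, neg_sub]
      rw [hs, hs]
      by_cases hq2 : q.2 ∈ Set.Ioo 0 T
      · rw [hpde q (Set.Ioo_subset_Icc_self hq2)]
        have : G q = ρ q * χ q := hGeq q.1 q.2 hq2
        rw [this]
        simp only [Vf]
        ring
      · have hq3 := fun h => hq2 (hsub h)
        have h1 : η (q.2 - t₁) = 0 := by
          apply bmp_zero
          by_contra h
          rw [not_le, abs_lt] at h
          exact hq3 ⟨by linarith [h.1], by linarith [h.2]⟩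
        have h2 : η (q.2 - t₂) = 0 := by
          apply bmp_zero
          by_contra h
          rw [not_le, abs_lt] at h
          exact hq3 ⟨by linarith [h.1], by linarith [h.2]⟩
        have h3 : θ q.2 = 0 := Th_zero t₁ t₂ h12 n q.2 hq3
        rw [h3, ← hη, h1, h2]
        simp
    simp only [hr, hl] at hk
    rw [← hk]
    have hηc : Continuous η := (bmp ℝ n).continuous_normed
    obtain ⟨B, hB⟩ := (bmp ℝ n).hasCompactSupport_normed.exists_bound_of_continuous hηc
    have hFint : ∀ s, Integrable (fun t => η (s - t) * F t) volume := by
      intro s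
      exact hFi.bdd_mul (hηc.comp (continuous_const.sub continuous_id)).aestronglyMeasurable
        (Filter.Eventually.of_forall fun t => hB (s - t))
    have hGint : Integrable (fun q : (((Fin N → ℝ) × ℝ) × ℝ) => G q * (η (t₁ - q.2) - η (t₂ - q.2)))
        ((volume : Measure ((Fin N → ℝ) × ℝ)).prod (volume : Measure ℝ)) := by
      refine Integrable.mul_bdd (c := B + B) hGi ?_ ?_
      · exact Continuous.aestronglyMeasurable (by fun_prop)
      · exact Filter.Eventually.of_forall fun q =>
          (norm_sub_le _ _).trans (add_le_add (hB _) (hB _))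
    have hfub : ∫ q : (((Fin N → ℝ) × ℝ) × ℝ), G q * (η (t₁ - q.2) - η (t₂ - q.2))
        = ∫ t, (η (t₁ - t) - η (t₂ - t)) * F t := by
      refine (integral_prod_symm _ hGint).trans ?_
      congr 1
      ext t
      simp only
      rw [integral_mul_const, mul_comm]
    rw [hfub, convolution_lsmul_swap, convolution_lsmul_swap]
    simp only [smul_eq_mul]
    rw [← integral_sub (hFint t₁) (hFint t₂)]
    congr 1
    ext t
    ring
  have hlim : Filter.Tendsto (fun n => ∫ q : (((Fin N → ℝ) × ℝ) × ℝ), Th t₁ t₂ n q.2 * fderiv ℝ ρ q e ∂m) Filter.atTop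
      (nhds (∫ q : (((Fin N → ℝ) × ℝ) × ℝ), (Set.Ioo t₁ t₂).indicator (fun _ => 1) q.2 * fderiv ℝ ρ q e ∂m)) := by
    apply tendsto_integral_of_dominated_convergence (fun _ => |M|)
    · intro n
      exact (((Th_contDiff t₁ t₂ n).continuous.comp continuous_snd).mul hDc).aestronglyMeasurable
    · exact integrable_const _
    · intro n
      have : ∀ᵐ q ∂m, q.2 ∈ Set.Ioo 0 T := hmsupp
      filter_upwards [this] with q hq
      rw [norm_mul, Real.norm_eq_abs (Th t₁ t₂ n q.2)]
      calc _ ≤ 1 * |M| := mul_le_mul (Th_bound _ _ _ _) (hDb q (Set.Ioo_subset_Icc_self hq))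
            (norm_nonneg _) zero_le_one
        _ = |M| := one_mul _
    · have k1 : ∀ᵐ q ∂m, q.2 ≠ t₁ := by rw [ae_iff]; simpa using hm1
      have k2 : ∀ᵐ q ∂m, q.2 ≠ t₂ := by rw [ae_iff]; simpa using hm2
      filter_upwards [k1, k2] with q h1 h2
      exact (Th_tendsto t₁ t₂ h12 q.2 h1 h2).mul_const _
  have hfin := tendsto_nhds_unique_of_eventuallyEq (hl1.sub hl2) hlim hid
  have hset : ∫ q in {q : (((Fin N → ℝ) × ℝ) × ℝ) | q.2 ∈ Set.Ioo t₁ t₂}, fderiv ℝ ρ q e ∂m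
      = ∫ q : (((Fin N → ℝ) × ℝ) × ℝ), (Set.Ioo t₁ t₂).indicator (fun _ => 1) q.2 * fderiv ℝ ρ q e ∂m := by
    rw [← integral_indicator (show MeasurableSet {q : ((Fin N → ℝ) × ℝ) × ℝ | q.2 ∈ Set.Ioo t₁ t₂} from
      measurable_snd measurableSet_Ioo)]
    congr 1
    ext q
    by_cases hq : q.2 ∈ Set.Ioo t₁ t₂
    · rw [Set.indicator_of_mem hq, one_mul, Set.indicator_of_mem (by exact hq)]
    · rw [Set.indicator_of_notMem hq, zero_mul, Set.indicator_of_notMem (by exact hq)]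
  rw [hset, ← hfin]
  ring
end
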